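/- arXiv:1711.06750 — 2 statements merged into one kernel-verified Lean document; each statement's English description precedes it below -/
import Mathlib

section
/- Let φ : A(𝕋) × A(𝕋) → ℂ be a bounded bilinear map and α ≥ 0 such that |φ(f,g)| ≤ α‖f‖_{A(𝕋)}‖g‖_{A(𝕋)} whenever f, g ∈ A(𝕋) satisfy supp f ∩ supp g = ∅. Then |φ(fg, h) − φ(f, gh)| ≤ 288π(1+√2)·α·‖f‖_{A(𝕋)}‖g‖_{A(𝕋)}‖h‖_{A(𝕋)} for all f, g, h ∈ A(𝕋). In particular, A(𝕋) has the strong property (B) with constant 288π(1+√2). -/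
open MeasureTheory AddCircle

noncomputable section

local instance : Fact (0 < 2 * Real.pi) := ⟨by positivity⟩

/-- The circle `𝕋 = ℝ/2πℤ`. -/
abbrev Circle2Pi : Type := AddCircle (2 * Real.pi)

/-- Membership in the Fourier algebra `A(𝕋)`: continuity together with absolute
summability of the Fourier coefficients. -/
def MemFourierAlg (f : Circle2Pi → ℂ) : Prop :=
  Continuous f ∧ Summable fun n : ℤ => ‖fourierCoeff f n‖

/-- The norm of the Fourier algebra `A(𝕋)`: `‖f‖ = ∑ₙ |f̂(n)|`. -/
def fourierAlgNorm (f : Circle2Pi → ℂ) : ℝ :=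
  ∑' n : ℤ, ‖fourierCoeff f n‖

/-- Normalized convolution on `𝕋` (with respect to the probability Haar measure). -/
def circleConv (f g : Circle2Pi → ℂ) : Circle2Pi → ℂ :=
  fun x => ∫ y : Circle2Pi, f y * g (x - y) ∂haarAddCircle



def ee (n : ℤ) : Circle2Pi → ℂ := fun x => fourier n x

lemma ee_norm (n : ℤ) (x : Circle2Pi) : ‖ee n x‖ = 1 := by
  simp only [ee, fourier_apply]; exact Circle.norm_coe _

lemma ee_cont (n : ℤ) : Continuous (ee n) := (fourier n).continuous

lemma ee_add (m n : ℤ) (x : Circle2Pi) : ee (m + n) x = ee m x * ee n x := by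
  simp [ee]

lemma ee_add' (n : ℤ) (x y : Circle2Pi) : ee n (x + y) = ee n x * ee n y := by
  simp [ee, fourier_apply, AddCircle.toCircle_add, smul_add]

lemma ee_smul (m n : ℤ) (x : Circle2Pi) : ee n (m • x) = ee (m * n) x := by
  simp [ee, fourier_apply, smul_smul, mul_comm]

lemma ee_neg (n : ℤ) (x : Circle2Pi) : ee n (-x) = ee (-n) x := by
  simp only [ee, fourier_apply, smul_neg, neg_smul]

lemma ee_zero (x : Circle2Pi) : ee 0 x = 1 := by simp [ee]
lemma ee_zero' (n : ℤ) : ee n 0 = 1 := by simp [ee]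

lemma ee_int (n : ℤ) : ∫ x : Circle2Pi, ee n x ∂haarAddCircle = if n = 0 then 1 else 0 := by
  have h := congrFun (fourierCoeff_fourier (T := 2 * Real.pi) n) 0
  simp only [fourierCoeff, neg_zero, fourier_zero, one_smul] at h
  unfold ee
  rw [h, Pi.single_apply]
  simp [eq_comm]

lemma int_series {ι : Type} [Countable ι] (a : ι → ℂ) (ν : ι → ℤ)
    (ha : Summable fun i => ‖a i‖) :
    ∫ x : Circle2Pi, (∑' i, a i * ee (ν i) x) ∂haarAddCircle
      = ∑' i, if ν i = 0 then a i else 0 := by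
  have := hasSum_integral_of_summable_integral_norm (μ := (haarAddCircle : Measure Circle2Pi))
    (F := fun i x => a i * ee (ν i) x) (fun i => by
      apply Continuous.integrable_of_hasCompactSupport
      · exact continuous_const.mul (ee_cont _)
      · exact HasCompactSupport.of_compactSpace _) (by
      simpa [ee_norm] using ha)
  rw [← this.tsum_eq]
  congr 1; ext i
  rw [integral_const_mul, ee_int]
  split_ifs <;> simp

lemma gen {ι : Type} [Countable ι] (a : ι → ℂ) (ν : ι → ℤ)
    (ha : Summable fun i => ‖a i‖) (F : Circle2Pi → ℂ)
    (hF : ∀ x, F x = ∑' i, a i * ee (ν i) x) :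
    MemFourierAlg F ∧ fourierAlgNorm F ≤ ∑' i, ‖a i‖ := by
  have hc : Continuous F := by
    have : F = fun x => ∑' i, a i * ee (ν i) x := funext hF
    rw [this]
    exact continuous_tsum (fun i => continuous_const.mul (ee_cont _)) ha
      (fun i x => by simp [ee_norm])
  have hco : ∀ n, fourierCoeff F n = ∑' i, if ν i = n then a i else 0 := by
    intro n
    have := int_series a (fun i => ν i - n) ha
    simp only [sub_eq_zero] at this
    rw [← this, fourierCoeff]
    congr 1; ext x
    rw [hF x, smul_eq_mul, ← tsum_mul_left]
    congr 1; ext i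
    rw [sub_eq_add_neg, ee_add]
    simp only [ee]; ring
  have hsn : ∀ n, Summable fun i => ‖if ν i = n then a i else 0‖ := by
    intro n
    refine Summable.of_nonneg_of_le (fun _ => norm_nonneg _) (fun i => ?_) ha
    split_ifs <;> simp
  have hb : ∀ s : Finset ℤ, ∑ n ∈ s, ‖fourierCoeff F n‖ ≤ ∑' i, ‖a i‖ := by
    intro s
    calc ∑ n ∈ s, ‖fourierCoeff F n‖
        ≤ ∑ n ∈ s, ∑' i, ‖if ν i = n then a i else 0‖ := by
          refine Finset.sum_le_sum fun n _ => ?_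
          rw [hco]; exact norm_tsum_le_tsum_norm (hsn n)
      _ = ∑' i, ∑ n ∈ s, ‖if ν i = n then a i else 0‖ :=
          (Summable.tsum_finsetSum fun n _ => hsn n).symm
      _ ≤ ∑' i, ‖a i‖ := by
          refine Summable.tsum_le_tsum (fun i => ?_) (summable_sum fun n _ => hsn n) ha
          have : ∀ n, ‖if ν i = n then a i else 0‖ = if ν i = n then ‖a i‖ else 0 := by
            intro n; split_ifs <;> simp
          simp only [this, Finset.sum_ite_eq]
          split_ifs <;> simp
  exact ⟨⟨hc, summable_of_sum_le (fun _ => norm_nonneg _) hb⟩,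
    Real.tsum_le_of_sum_le (fun _ => norm_nonneg _) hb⟩

lemma mem_series {f : Circle2Pi → ℂ} (hf : MemFourierAlg f) (x : Circle2Pi) :
    f x = ∑' n, fourierCoeff f n * ee n x := by
  have := has_pointwise_sum_fourier_series_of_summable (f := ⟨f, hf.1⟩) hf.2.of_norm x
  exact this.tsum_eq.symm

lemma ee_mem (n : ℤ) : MemFourierAlg (ee n) ∧ fourierAlgNorm (ee n) ≤ 1 := by
  have := gen (ι := Unit) (fun _ => 1) (fun _ => n) (by simpa using Summable.of_finite) (ee n)
    (by intro x; simp)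
  simpa using this

lemma norm_nn (f : Circle2Pi → ℂ) : 0 ≤ fourierAlgNorm f := tsum_nonneg fun _ => norm_nonneg _

lemma L_series {ι : Type} [Countable ι] (a : ι → ℂ) (ν : ι → ℤ)
    (ha : Summable fun i => ‖a i‖) (F : Circle2Pi → ℂ)
    (hF : ∀ x, F x = ∑' i, a i * ee (ν i) x)
    (L : (Circle2Pi → ℂ) →ₗ[ℂ] ℂ) (K : ℝ)
    (hL : ∀ f, MemFourierAlg f → ‖L f‖ ≤ K * fourierAlgNorm f) :
    HasSum (fun i => a i * L (ee (ν i))) (L F) := by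
  classical
  rw [HasSum, SummationFilter.unconditional_filter]
  rw [tendsto_iff_norm_sub_tendsto_zero]
  have h0 : Filter.Tendsto (fun s : Finset ι => |K| * ∑' i : {x // x ∉ s}, ‖a i‖)
      Filter.atTop (nhds 0) := by
    simpa using (tendsto_tsum_compl_atTop_zero (fun i => ‖a i‖)).const_mul |K|
  refine squeeze_zero (fun _ => norm_nonneg _) (fun s => ?_) h0
  have hg := gen (ι := {x // x ∉ s}) (fun i => a i) (fun i => ν i) (ha.subtype _)
    (F - ∑ i ∈ s, a i • ee (ν i)) (by
      intro x
      have hs : Summable fun i => a i * ee (ν i) x := by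
        apply Summable.of_norm; simpa [ee_norm] using ha
      have := hs.sum_add_tsum_subtype_compl s
      simp only [Pi.sub_apply, Finset.sum_apply, Pi.smul_apply, smul_eq_mul]
      rw [hF x, ← this]; ring)
  have e : ∑ i ∈ s, a i * L (ee (ν i)) - L F = - L (F - ∑ i ∈ s, a i • ee (ν i)) := by
    simp
  rw [e, norm_neg]
  refine (hL _ hg.1).trans ?_
  refine (mul_le_mul_of_nonneg_right (le_abs_self K) (norm_nn _)).trans ?_
  exact mul_le_mul_of_nonneg_left hg.2 (abs_nonneg _)

lemma L_bound (L : (Circle2Pi → ℂ) →ₗ[ℂ] ℂ) (K : ℝ)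
    (hL : ∀ f, MemFourierAlg f → ‖L f‖ ≤ K * fourierAlgNorm f) (C : ℝ)
    (hC : ∀ n, ‖L (ee n)‖ ≤ C) (f : Circle2Pi → ℂ) (hf : MemFourierAlg f) :
    ‖L f‖ ≤ C * fourierAlgNorm f := by
  have h := L_series (fun n => fourierCoeff f n) (fun n => n) hf.2 f (mem_series hf) L K hL
  rw [← h.tsum_eq, fourierAlgNorm, mul_comm C, ← tsum_mul_right]
  refine tsum_of_norm_bounded (hf.2.mul_right C).hasSum fun n => ?_
  rw [norm_mul]
  exact mul_le_mul_of_nonneg_left (hC n) (norm_nonneg _)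

lemma mul_mem {f g : Circle2Pi → ℂ} (hf : MemFourierAlg f) (hg : MemFourierAlg g) :
    MemFourierAlg (fun x => f x * g x) ∧
      fourierAlgNorm (fun x => f x * g x) ≤ fourierAlgNorm f * fourierAlgNorm g := by
  have hs := hf.2.mul_of_nonneg hg.2 (fun _ => norm_nonneg _) (fun _ => norm_nonneg _)
  have := gen (ι := ℤ × ℤ) (fun p => fourierCoeff f p.1 * fourierCoeff g p.2)
    (fun p => p.1 + p.2) (by simpa using hs) (fun x => f x * g x) (by
      intro x
      have h1 : Summable fun n => ‖fourierCoeff f n * ee n x‖ := by simpa [ee_norm] using hf.2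
      have h2 : Summable fun n => ‖fourierCoeff g n * ee n x‖ := by simpa [ee_norm] using hg.2
      rw [mem_series hf x, mem_series hg x, tsum_mul_tsum_of_summable_norm h1 h2]
      congr 1; ext p
      rw [ee_add]; ring)
  refine ⟨this.1, this.2.trans (le_of_eq ?_)⟩
  rw [fourierAlgNorm, fourierAlgNorm, hf.2.tsum_mul_tsum hg.2 hs]
  simp

lemma bil_series {ι : Type} [Countable ι] (a b : ι → ℂ) (ν μ : ι → ℤ)
    (ha : Summable fun i => ‖a i‖) (hb : Summable fun i => ‖b i‖) (F G : Circle2Pi → ℂ)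
    (hF : ∀ x, F x = ∑' i, a i * ee (ν i) x)
    (hG : ∀ x, G x = ∑' i, b i * ee (μ i) x)
    (φ : (Circle2Pi → ℂ) →ₗ[ℂ] (Circle2Pi → ℂ) →ₗ[ℂ] ℂ) (K : ℝ)
    (hK : ∀ f g : Circle2Pi → ℂ, MemFourierAlg f → MemFourierAlg g →
        ‖φ f g‖ ≤ K * fourierAlgNorm f * fourierAlgNorm g) :
    φ F G = ∑' p : ι × ι, a p.1 * b p.2 * φ (ee (ν p.1)) (ee (μ p.2)) := by
  have hG' := gen b μ hb G hG
  have h1 := L_series a ν ha F hF (φ.flip G) (K * fourierAlgNorm G) (fun f hf => by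
    rw [LinearMap.flip_apply]
    refine (hK f G hf hG'.1).trans (le_of_eq (by ring)))
  have h2 : ∀ i, φ (ee (ν i)) G = ∑' j, b j * φ (ee (ν i)) (ee (μ j)) := fun i =>
    (L_series b μ hb G hG (φ (ee (ν i))) (K * fourierAlgNorm (ee (ν i)))
      (fun g hg => hK _ g (ee_mem _).1 hg)).tsum_eq.symm
  have hs : Summable fun p : ι × ι => a p.1 * b p.2 * φ (ee (ν p.1)) (ee (μ p.2)) := by
    apply Summable.of_norm
    have := (ha.mul_of_nonneg hb (fun _ => norm_nonneg _) (fun _ => norm_nonneg _)).mul_right |K|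
    refine Summable.of_nonneg_of_le (fun _ => norm_nonneg _) (fun p => ?_) this
    rw [norm_mul, norm_mul]
    refine mul_le_mul_of_nonneg_left ?_ (by positivity)
    refine (hK _ _ (ee_mem _).1 (ee_mem _).1).trans ?_
    have h3 := (ee_mem (ν p.1)).2
    have h4 := (ee_mem (μ p.2)).2
    have h5 := norm_nn (ee (ν p.1))
    have h6 := norm_nn (ee (μ p.2))
    rw [mul_assoc]
    calc K * (fourierAlgNorm (ee (ν p.1)) * fourierAlgNorm (ee (μ p.2)))
        ≤ |K| * (1 * 1) := by gcongr; exact le_abs_self K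
      _ = |K| := by ring
  rw [hs.tsum_prod]
  simp only [LinearMap.flip_apply] at h1
  rw [← h1.tsum_eq]
  congr 1; ext i
  rw [h2, ← tsum_mul_left]
  congr 1; ext j
  simp only; ring

lemma key (φ : (Circle2Pi → ℂ) →ₗ[ℂ] (Circle2Pi → ℂ) →ₗ[ℂ] ℂ) (K α : ℝ) (hα : 0 ≤ α)
    (hK : ∀ f g : Circle2Pi → ℂ, MemFourierAlg f → MemFourierAlg g →
        ‖φ f g‖ ≤ K * fourierAlgNorm f * fourierAlgNorm g)
    (hd : ∀ f g : Circle2Pi → ℂ, MemFourierAlg f → MemFourierAlg g →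
        tsupport f ∩ tsupport g = ∅ →
        ‖φ f g‖ ≤ α * fourierAlgNorm f * fourierAlgNorm g)
    (a b : ℤ → ℂ) (ha : Summable fun i => ‖a i‖) (hb : Summable fun i => ‖b i‖)
    (A B : Circle2Pi → ℂ)
    (hA : ∀ x, A x = ∑' i, a i * ee i x) (hB : ∀ x, B x = ∑' i, b i * ee i x)
    (hAB : tsupport A ∩ tsupport B = ∅) (j l k : ℤ) :
    ‖∑' n, a n * b (-n) * φ (ee (j + k * n)) (ee (l - k * n))‖
      ≤ α * (∑' n, ‖a n‖) * (∑' n, ‖b n‖) := by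
  have hKc : ∀ m n, ‖φ (ee m) (ee n)‖ ≤ |K| := by
    intro m n
    refine (hK _ _ (ee_mem _).1 (ee_mem _).1).trans ?_
    have h3 := (ee_mem m).2
    have h4 := (ee_mem n).2
    have h5 := norm_nn (ee m)
    have h6 := norm_nn (ee n)
    rw [mul_assoc]
    calc K * (fourierAlgNorm (ee m) * fourierAlgNorm (ee n))
        ≤ |K| * (1 * 1) := by gcongr; exact le_abs_self K
      _ = |K| := by ring
  have expand : ∀ (c : ℤ → ℂ) (C : Circle2Pi → ℂ) (hC : ∀ x, C x = ∑' i, c i * ee i x)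
      (j : ℤ) (r x : Circle2Pi), ee j x * C (k • x - r)
        = ∑' i, (c i * ee (-i) r) * ee (j + k * i) x := by
    intro c C hC j r x
    rw [hC, ← tsum_mul_left]
    congr 1; ext i
    rw [sub_eq_add_neg, ee_add', ee_neg, ee_smul, ee_add]; ring
  have supp : ∀ (C : Circle2Pi → ℂ) (j : ℤ) (r : Circle2Pi),
      tsupport (fun x => ee j x * C (k • x - r)) ⊆ (fun x => k • x - r) ⁻¹' tsupport C := by
    intro C j r
    refine closure_minimal ?_ ?_
    · intro x hx
      apply subset_tsupport
      exact right_ne_zero_of_mul hx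
    · exact (isClosed_tsupport C).preimage (by fun_prop)
  let c : ℤ × ℤ → ℂ := fun p => a p.1 * b p.2 * φ (ee (j + k * p.1)) (ee (l + k * p.2))
  have hc : Summable fun p => ‖c p‖ := by
    have := (ha.mul_of_nonneg hb (fun _ => norm_nonneg _) (fun _ => norm_nonneg _)).mul_right |K|
    refine Summable.of_nonneg_of_le (fun _ => norm_nonneg _) (fun p => ?_) this
    simp only [c]
    rw [norm_mul, norm_mul]
    exact mul_le_mul_of_nonneg_left (hKc _ _) (by positivity)
  have hbd : ∀ r, ‖∑' p, c p * ee (-(p.1 + p.2)) r‖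
      ≤ α * (∑' n, ‖a n‖) * (∑' n, ‖b n‖) := by
    intro r
    have hsa : Summable fun i => ‖a i * ee (-i) r‖ := by simpa [ee_norm] using ha
    have hsb : Summable fun i => ‖b i * ee (-i) r‖ := by simpa [ee_norm] using hb
    have h1 := bil_series _ _ _ _ hsa hsb _ _ (expand a A hA j r) (expand b B hB l r) φ K hK
    have h2 : ∑' p, c p * ee (-(p.1 + p.2)) r
        = φ (fun x => ee j x * A (k • x - r)) (fun x => ee l x * B (k • x - r)) := by
      rw [h1]
      congr 1; ext p
      simp only [c]
      rw [neg_add, ee_add]; ring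
    rw [h2]
    have ga := gen _ _ hsa _ (expand a A hA j r)
    have gb := gen _ _ hsb _ (expand b B hB l r)
    refine (hd _ _ ga.1 gb.1 ?_).trans ?_
    · rw [Set.eq_empty_iff_forall_notMem]
      rintro x ⟨h3, h4⟩
      have : k • x - r ∈ tsupport A ∩ tsupport B := ⟨supp A j r h3, supp B l r h4⟩
      rw [hAB] at this; exact this
    · have h3 := ga.2
      have h4 := gb.2
      simp only [norm_mul, ee_norm, mul_one] at h3 h4
      have h5 := norm_nn (fun x => ee j x * A (k • x - r))
      have h6 := norm_nn (fun x => ee l x * B (k • x - r))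
      have h7 : 0 ≤ ∑' n, ‖a n‖ := tsum_nonneg fun _ => norm_nonneg _
      gcongr
  have hi := int_series c (fun p => -(p.1 + p.2)) hc
  have hre : ∑' p : ℤ × ℤ, (if -(p.1 + p.2) = 0 then c p else 0)
      = ∑' n, a n * b (-n) * φ (ee (j + k * n)) (ee (l - k * n)) := by
    have hs : Summable fun p : ℤ × ℤ => (if -(p.1 + p.2) = 0 then c p else 0) := by
      apply Summable.of_norm
      refine Summable.of_nonneg_of_le (fun _ => norm_nonneg _) (fun p => ?_) hc
      split_ifs <;> simp
    rw [hs.tsum_prod]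
    congr 1; ext n
    rw [tsum_eq_single (-n)]
    · simp [c, sub_eq_add_neg]
    · intro m hm
      rw [if_neg]
      intro h; apply hm; simp only at h; omega
  rw [← hre, ← hi]
  have := norm_integral_le_of_norm_le_const (μ := (haarAddCircle : Measure Circle2Pi))
    (Filter.Eventually.of_forall hbd)
  simpa using this

def tc (h : ℝ) (n : ℤ) : ℝ :=
  (if n = 0 then h ^ 2 else 0) + Real.sin (Real.pi * n * h) ^ 2 / (Real.pi * n) ^ 2

lemma tc_nonneg (h : ℝ) (n : ℤ) : 0 ≤ tc h n := by
  unfold tc; split_ifs <;> positivity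

lemma tc_neg (h : ℝ) (n : ℤ) : tc h (-n) = tc h n := by
  unfold tc; simp

lemma tc_summable (h : ℝ) : Summable (tc h) := by
  apply Summable.add
  · exact (hasSum_ite_eq 0 (h ^ 2)).summable
  · refine Summable.of_nonneg_of_le (fun _ => by positivity) (fun n => ?_)
      (((Real.summable_one_div_int_pow (p := 2)).2 (by norm_num)).mul_left (1 / Real.pi ^ 2))
    rw [mul_pow, div_mul_div_comm, mul_one]
    exact div_le_div_of_nonneg_right (Real.sin_sq_le_one _) (by positivity)

lemma C_sum (y : ℝ) (hy : y ∈ Set.Icc (0 : ℝ) 1) :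
    HasSum (fun n : ℕ => 1 / (n : ℝ) ^ 2 * Real.cos (2 * Real.pi * n * y))
      (Real.pi ^ 2 * (y ^ 2 - y + 1 / 6)) := by
  have h := hasSum_one_div_nat_pow_mul_cos (k := 1) (by norm_num) hy
  have hb : Polynomial.eval y (Polynomial.map (algebraMap ℚ ℝ) (Polynomial.bernoulli (2 * 1)))
      = y ^ 2 - y + 1 / 6 := by
    simp [Polynomial.bernoulli, Finset.sum_range_succ, Polynomial.eval_add, bernoulli_two,
      bernoulli_one, Polynomial.map_add]
    ring
  rw [hb] at h
  convert h using 1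
  norm_num [Nat.factorial]; ring_nf; try simp

lemma ee_coe (n : ℤ) (y : ℝ) : ee n ((2 * Real.pi * y : ℝ) : Circle2Pi)
    = Complex.exp ((2 * Real.pi * n * y : ℝ) * Complex.I) := by
  have := Real.pi_ne_zero
  simp only [ee, fourier_coe_apply]
  congr 1
  push_cast
  have : (Real.pi : ℂ) ≠ 0 := by exact_mod_cast this
  field_simp

def tent (h : ℝ) (x : Circle2Pi) : ℂ := ∑' n, (tc h n : ℂ) * ee n x

lemma tent_value (h y σ : ℝ)
    (hs : HasSum (fun n : ℕ => Real.sin (Real.pi * n * h) ^ 2 / (Real.pi * n) ^ 2 *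
      (2 * Real.cos (2 * Real.pi * n * y))) σ) :
    tent h ((2 * Real.pi * y : ℝ) : Circle2Pi) = ((h ^ 2 + σ : ℝ) : ℂ) := by
  have hsum : Summable fun n => (tc h n : ℂ) * ee n ((2 * Real.pi * y : ℝ) : Circle2Pi) := by
    apply Summable.of_norm
    simp only [norm_mul, ee_norm, mul_one, Complex.norm_real, Real.norm_eq_abs,
      abs_of_nonneg (tc_nonneg h _)]
    exact tc_summable h
  have h1 := hsum.hasSum.nat_add_neg
  have h2 : HasSum (fun n : ℕ => (((if n = 0 then 2 * h ^ 2 else 0) +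
      Real.sin (Real.pi * n * h) ^ 2 / (Real.pi * n) ^ 2 *
      (2 * Real.cos (2 * Real.pi * n * y)) : ℝ) : ℂ)) ((2 * h ^ 2 + σ : ℝ) : ℂ) := by
    exact_mod_cast (hasSum_ite_eq 0 (2 * h ^ 2)).add hs
  have h3 : (fun n : ℕ => (tc h (n : ℤ) : ℂ) * ee n ((2 * Real.pi * y : ℝ) : Circle2Pi) +
      (tc h (-(n : ℤ)) : ℂ) * ee (-(n : ℤ)) ((2 * Real.pi * y : ℝ) : Circle2Pi)) =
      (fun n : ℕ => (((if n = 0 then 2 * h ^ 2 else 0) +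
      Real.sin (Real.pi * n * h) ^ 2 / (Real.pi * n) ^ 2 *
      (2 * Real.cos (2 * Real.pi * n * y)) : ℝ) : ℂ)) := by
    ext n
    rw [tc_neg]
    rcases Nat.eq_zero_or_pos n with rfl | hn
    · simp [tc, ee_zero]; ring
    · have hn' : n ≠ 0 := hn.ne'
      have : (n : ℤ) ≠ 0 := by exact_mod_cast hn'
      rw [← mul_add, ee_coe, ee_coe, tc, if_neg this, if_neg hn']
      push_cast
      rw [Complex.two_cos]
      ring_nf
  rw [h3] at h1
  have h4 := h1.unique h2
  have h5 : (tc h 0 : ℂ) * ee 0 ((2 * Real.pi * y : ℝ) : Circle2Pi) = ((h ^ 2 : ℝ) : ℂ) := by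
    simp [tc, ee_zero]
  rw [h5] at h4
  have : tent h ((2 * Real.pi * y : ℝ) : Circle2Pi) =
    ((2 * h ^ 2 + σ : ℝ) : ℂ) - ((h ^ 2 : ℝ) : ℂ) := by rw [← h4, tent]; ring
  rw [this]; push_cast; ring

lemma trig_id (n : ℕ) (h y : ℝ) :
    Real.sin (Real.pi * n * h) ^ 2 / (Real.pi * n) ^ 2 * (2 * Real.cos (2 * Real.pi * n * y))
    = 1 / Real.pi ^ 2 * (1 / (n : ℝ) ^ 2 * Real.cos (2 * Real.pi * n * y)
      - (1 / 2 * (1 / (n : ℝ) ^ 2 * Real.cos (2 * Real.pi * n * (y + h)))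
      + 1 / 2 * (1 / (n : ℝ) ^ 2 * Real.cos (2 * Real.pi * n * (y - h))))) := by
  have e1 : Real.cos (2 * Real.pi * n * (y + h)) + Real.cos (2 * Real.pi * n * (y - h))
      = 2 * Real.cos (2 * Real.pi * n * y) * (1 - 2 * Real.sin (Real.pi * n * h) ^ 2) := by
    have : 1 - 2 * Real.sin (Real.pi * n * h) ^ 2 = Real.cos (2 * Real.pi * n * h) := by
      rw [show 2 * Real.pi * n * h = 2 * (Real.pi * n * h) by ring, Real.cos_two_mul,
        Real.cos_sq']; ring
    rw [this, mul_add, mul_sub, Real.cos_add, Real.cos_sub]; ring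
  have e2 : Real.cos (2 * Real.pi * n * (y + h)) = 2 * Real.cos (2 * Real.pi * n * y) *
    (1 - 2 * Real.sin (Real.pi * n * h) ^ 2) - Real.cos (2 * Real.pi * n * (y - h)) := by
    linarith
  rw [e2, mul_pow, div_eq_mul_inv, mul_inv]
  simp only [one_div]
  ring

lemma tent_zero (h : ℝ) (h0 : 0 ≤ h) (y : ℝ) (h1 : h ≤ y) (h2 : y ≤ 1 - h) :
    tent h ((2 * Real.pi * y : ℝ) : Circle2Pi) = 0 := by
  rw [tent_value h y (-h ^ 2)]
  · simp
  simp only [trig_id]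
  have a1 := C_sum y ⟨by linarith, by linarith⟩
  have a2 := C_sum (y + h) ⟨by linarith, by linarith⟩
  have a3 := C_sum (y - h) ⟨by linarith, by linarith⟩
  have := Real.pi_ne_zero
  have e : -h ^ 2 = 1 / Real.pi ^ 2 * (Real.pi ^ 2 * (y ^ 2 - y + 1 / 6)
      - (1 / 2 * (Real.pi ^ 2 * ((y + h) ^ 2 - (y + h) + 1 / 6))
      + 1 / 2 * (Real.pi ^ 2 * ((y - h) ^ 2 - (y - h) + 1 / 6)))) := by
    field_simp; ring
  rw [e]
  exact (a1.sub ((a2.mul_left (1 / 2)).add (a3.mul_left (1 / 2)))).mul_left (1 / Real.pi ^ 2)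

lemma tent_at_zero (h : ℝ) (h0 : 0 ≤ h) (h1 : h ≤ 1) : tent h 0 = (h : ℂ) := by
  have := tent_value h 0 (h - h ^ 2) (by
    simp only [trig_id]
    have a1 := C_sum 0 ⟨by linarith, by linarith⟩
    have a2 := C_sum h ⟨by linarith, by linarith⟩
    have e : ∀ n : ℕ, Real.cos (2 * Real.pi * n * (0 - h)) = Real.cos (2 * Real.pi * n * h) := by
      intro n; rw [← Real.cos_neg]; congr 1; ring
    simp only [e, zero_add]
    have := Real.pi_ne_zero
    have e' : h - h ^ 2 = 1 / Real.pi ^ 2 * (Real.pi ^ 2 * (0 ^ 2 - 0 + 1 / 6)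
      - (1 / 2 * (Real.pi ^ 2 * (h ^ 2 - h + 1 / 6))
      + 1 / 2 * (Real.pi ^ 2 * (h ^ 2 - h + 1 / 6)))) := by
      field_simp; ring
    rw [e']
    exact (a1.sub ((a2.mul_left (1 / 2)).add (a2.mul_left (1 / 2)))).mul_left
      (1 / Real.pi ^ 2))
  simpa using this

lemma tc_tsum (h : ℝ) (h0 : 0 ≤ h) (h1 : h ≤ 1) : ∑' n, tc h n = h := by
  have := tent_at_zero h h0 h1
  simp only [tent, ee_zero', mul_one] at this
  exact_mod_cast this

lemma tent_supp (h : ℝ) (h0 : 0 ≤ h) (x : Circle2Pi) (hx : tent h x ≠ 0) :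
    ‖x‖ ≤ 2 * Real.pi * h := by
  have hp : 0 < 2 * Real.pi := by positivity
  have hx' : x ∈ ((↑) : ℝ → Circle2Pi) '' Set.Ico 0 (0 + 2 * Real.pi) := by
    rw [AddCircle.coe_image_Ico_eq]; trivial
  obtain ⟨z, ⟨hz0, hz1⟩, rfl⟩ := hx'
  obtain ⟨y, rfl⟩ : ∃ y, z = 2 * Real.pi * y := ⟨z / (2 * Real.pi), by field_simp⟩
  have hy0 : 0 ≤ y := nonneg_of_mul_nonneg_right hz0 hp
  have hy1 : y < 1 := by
    rw [zero_add] at hz1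
    by_contra hc
    nlinarith
  rcases lt_or_ge y h with h1 | h1
  · refine (QuotientAddGroup.norm_mk_le_norm).trans ?_
    rw [Real.norm_eq_abs, abs_of_nonneg hz0]
    gcongr
  · rcases le_or_gt y (1 - h) with h2 | h2
    · exact absurd (tent_zero h h0 y h1 h2) hx
    · have : ((2 * Real.pi * y : ℝ) : Circle2Pi) = ((2 * Real.pi * (y - 1) : ℝ) : Circle2Pi) := by
        rw [← AddCircle.coe_add_period _ (2 * Real.pi * (y - 1))]; congr 1; ring
      rw [this]
      refine (QuotientAddGroup.norm_mk_le_norm).trans ?_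
      rw [Real.norm_eq_abs, abs_of_nonpos (by nlinarith), ← mul_neg]
      gcongr; linarith

lemma tents (φ : (Circle2Pi → ℂ) →ₗ[ℂ] (Circle2Pi → ℂ) →ₗ[ℂ] ℂ) (K α : ℝ) (hα : 0 ≤ α)
    (hK : ∀ f g : Circle2Pi → ℂ, MemFourierAlg f → MemFourierAlg g →
        ‖φ f g‖ ≤ K * fourierAlgNorm f * fourierAlgNorm g)
    (hd : ∀ f g : Circle2Pi → ℂ, MemFourierAlg f → MemFourierAlg g →
        tsupport f ∩ tsupport g = ∅ →
        ‖φ f g‖ ≤ α * fourierAlgNorm f * fourierAlgNorm g)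
    (h₁ h₂ : ℝ) (h10 : 0 ≤ h₁) (h20 : 0 ≤ h₂) (h11 : h₁ ≤ 1) (h21 : h₂ ≤ 1) (c : Circle2Pi)
    (hc : 2 * Real.pi * (h₁ + h₂) < ‖c‖) (j l k : ℤ) :
    ‖∑' n : ℤ, (tc h₁ n : ℂ) * tc h₂ n * ee n c * φ (ee (j + k * n)) (ee (l - k * n))‖
      ≤ α * h₁ * h₂ := by
  have sn : ∀ h n, ‖(tc h n : ℂ)‖ = tc h n := fun h n => by
    rw [Complex.norm_real, Real.norm_of_nonneg (tc_nonneg h n)]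
  have cl : ∀ (h : ℝ) (c : Circle2Pi), 0 ≤ h →
      tsupport (fun x => tent h (x - c)) ⊆ {x | ‖x - c‖ ≤ 2 * Real.pi * h} := by
    intro h c h0
    refine closure_minimal ?_ (isClosed_le (by fun_prop) continuous_const)
    intro x hx
    exact tent_supp h h0 _ hx
  have := key φ K α hα hK hd (fun n => tc h₁ n) (fun n => tc h₂ n * ee (-n) c)
    (by simpa only [sn] using tc_summable h₁)
    (by simpa only [norm_mul, ee_norm, mul_one, sn] using tc_summable h₂)
    (fun x => tent h₁ (x - 0)) (fun x => tent h₂ (x - c))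
    (fun x => by simp [tent])
    (fun x => by
      simp only [tent]
      congr 1; ext n
      rw [sub_eq_add_neg, ee_add', ee_neg]; ring) (by
      rw [Set.eq_empty_iff_forall_notMem]
      rintro x ⟨h3, h4⟩
      have h5 := cl _ _ h10 h3
      have h6 := cl _ _ h20 h4
      simp only [Set.mem_ofPred_eq, sub_zero] at h5 h6
      have h7 : ‖c‖ ≤ ‖x‖ + ‖x - c‖ := by
        have := norm_sub_le x (x - c)
        simpa using this
      linarith) j l k
  simp only [norm_mul, ee_norm, mul_one, sn, tc_tsum _ h10 h11, tc_tsum _ h20 h21, tc_neg,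
    neg_neg] at this
  refine le_trans (le_of_eq ?_) this
  congr 2; ext n; ring

lemma tents_nat (φ : (Circle2Pi → ℂ) →ₗ[ℂ] (Circle2Pi → ℂ) →ₗ[ℂ] ℂ) (K α : ℝ) (hα : 0 ≤ α)
    (hK : ∀ f g : Circle2Pi → ℂ, MemFourierAlg f → MemFourierAlg g →
        ‖φ f g‖ ≤ K * fourierAlgNorm f * fourierAlgNorm g)
    (hd : ∀ f g : Circle2Pi → ℂ, MemFourierAlg f → MemFourierAlg g →
        tsupport f ∩ tsupport g = ∅ →
        ‖φ f g‖ ≤ α * fourierAlgNorm f * fourierAlgNorm g)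
    (h₁ h₂ : ℝ) (h10 : 0 ≤ h₁) (h20 : 0 ≤ h₂) (h11 : h₁ ≤ 1) (h21 : h₂ ≤ 1) (c : Circle2Pi)
    (hc : 2 * Real.pi * (h₁ + h₂) < ‖c‖) (j l k : ℤ) :
    ∃ X : ℂ, ‖X‖ ≤ α * h₁ * h₂ ∧
    HasSum (fun n : ℕ => ((tc h₁ n * tc h₂ n : ℝ) : ℂ) *
      (ee n c * φ (ee (j + k * n)) (ee (l - k * n))
      + ee (-n) c * φ (ee (j - k * n)) (ee (l + k * n))))
      (X + ((tc h₁ 0 * tc h₂ 0 : ℝ) : ℂ) * φ (ee j) (ee l)) := by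
  refine ⟨_, tents φ K α hα hK hd h₁ h₂ h10 h20 h11 h21 c hc j l k, ?_⟩
  have hKc : ∀ m n, ‖φ (ee m) (ee n)‖ ≤ |K| := by
    intro m n
    refine (hK _ _ (ee_mem _).1 (ee_mem _).1).trans ?_
    have h3 := (ee_mem m).2
    have h4 := (ee_mem n).2
    have h5 := norm_nn (ee m)
    have h6 := norm_nn (ee n)
    rw [mul_assoc]
    calc K * (fourierAlgNorm (ee m) * fourierAlgNorm (ee n))
        ≤ |K| * (1 * 1) := by gcongr; exact le_abs_self K
      _ = |K| := by ring
  have sn : ∀ h n, ‖(tc h n : ℂ)‖ = tc h n := fun h n => by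
    rw [Complex.norm_real, Real.norm_of_nonneg (tc_nonneg h n)]
  have hs : Summable fun n : ℤ =>
      (tc h₁ n : ℂ) * tc h₂ n * ee n c * φ (ee (j + k * n)) (ee (l - k * n)) := by
    apply Summable.of_norm
    have ht : ∀ n, tc h₂ n ≤ h₂ := fun n => by
      have := (tc_summable h₂).le_tsum n (fun m _ => tc_nonneg h₂ m)
      rwa [tc_tsum _ h20 h21] at this
    refine Summable.of_nonneg_of_le (fun _ => norm_nonneg _) (fun n => ?_)
      ((tc_summable h₁).mul_right (h₂ * |K|))
    simp only [norm_mul, ee_norm, mul_one, sn]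
    rw [mul_assoc]
    have := tc_nonneg h₁ n
    gcongr
    · exact ht n
    · exact hKc _ _
  have := hs.hasSum.nat_add_neg
  convert this using 1
  · ext n
    simp only [tc_neg, mul_neg, sub_neg_eq_add, ← sub_eq_add_neg]
    push_cast; ring
  · simp [ee_zero]

lemma dom (D : ℕ → ℂ) (B0 : ℝ) (hB : ∀ n, ‖D n‖ ≤ B0) (hD0 : D 0 = 0) (w : ℕ → ℂ) (v : ℕ → ℝ)
    (V ε : ℝ) (hε : 0 ≤ ε) (hv : HasSum v V) (hv0 : v 0 = 0) (hwv : ∀ n, 2 ≤ n → ‖w n‖ ≤ v n)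
    (hpos : 0 < ‖w 1‖ - (V - v 1))
    (hX : ∀ k : ℕ, 1 ≤ k → ∃ X : ℂ, ‖X‖ ≤ ε ∧ HasSum (fun n => w n * D (k * n)) X) (k : ℕ) :
    (‖w 1‖ - (V - v 1)) * ‖D k‖ ≤ ε := by
  have hbdd : BddAbove (Set.range fun n => ‖D n‖) := ⟨B0, by rintro _ ⟨n, rfl⟩; exact hB n⟩
  set M := ⨆ n, ‖D n‖ with hM
  have hDM : ∀ n, ‖D n‖ ≤ M := fun n => le_ciSup hbdd n
  have hM0 : 0 ≤ M := (norm_nonneg _).trans (hDM 0)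
  have hvs : HasSum (fun n => (v n - if n = 1 then v 1 else 0) * M) ((V - v 1) * M) :=
    (hv.sub (hasSum_ite_eq 1 (v 1))).mul_right M
  have hbnd : ∀ n, (if n = 0 ∨ n = 1 then 0 else ‖w n‖ * M) ≤
      (v n - if n = 1 then v 1 else 0) * M := by
    intro n
    by_cases h0 : n = 0
    · simp [h0, hv0]
    by_cases h1 : n = 1
    · simp [h1]
    simp only [h0, h1, or_self, if_false, sub_zero]
    exact mul_le_mul_of_nonneg_right (hwv n (by omega)) hM0
  have hVM : 0 ≤ (V - v 1) * M := by
    rw [← hvs.tsum_eq]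
    refine tsum_nonneg fun n => le_trans ?_ (hbnd n)
    split_ifs <;> positivity
  have h1 : ∀ k, ‖w 1‖ * ‖D k‖ ≤ ε + (V - v 1) * M := by
    intro k
    rcases Nat.eq_zero_or_pos k with rfl | hk
    · rw [hD0]; simp; linarith
    obtain ⟨X, hXn, hXs⟩ := hX k hk
    have hs2 := hXs.sub (hasSum_ite_eq 1 (w 1 * D k))
    have h3 : ‖X - w 1 * D k‖ ≤ (V - v 1) * M := by
      rw [← hs2.tsum_eq]
      refine tsum_of_norm_bounded hvs fun n => le_trans ?_ (hbnd n)
      by_cases h0 : n = 0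
      · simp [h0, hD0]
      by_cases h1 : n = 1
      · simp [h1]
      simp only [h0, h1, or_self, if_false, sub_zero, norm_mul]
      exact mul_le_mul_of_nonneg_left (hDM _) (norm_nonneg _)
    rw [← norm_mul]
    calc ‖w 1 * D k‖ = ‖X - (X - w 1 * D k)‖ := by congr 1; ring
      _ ≤ ‖X‖ + ‖X - w 1 * D k‖ := norm_sub_le _ _
      _ ≤ _ := by linarith
  have hV : 0 ≤ V - v 1 := by
    rw [← (hv.sub (hasSum_ite_eq 1 (v 1))).tsum_eq]
    refine tsum_nonneg fun n => ?_
    by_cases h0 : n = 0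
    · simp [h0, hv0]
    by_cases h1 : n = 1
    · simp [h1]
    simp only [h1, if_false, sub_zero]
    exact (norm_nonneg _).trans (hwv n (by omega))
  have hw : 0 < ‖w 1‖ := by linarith
  have h2 : M ≤ (ε + (V - v 1) * M) / ‖w 1‖ := by
    refine ciSup_le fun n => ?_
    rw [le_div_iff₀ hw, mul_comm]; exact h1 n
  rw [le_div_iff₀ hw] at h2
  calc _ ≤ (‖w 1‖ - (V - v 1)) * M := mul_le_mul_of_nonneg_left (hDM k) hpos.le
    _ ≤ ε := by linarith

lemma hs_conv {E : Type} [AddCommMonoid E] [TopologicalSpace E] {f g : ℕ → E} {a b : E}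
    (h : HasSum f a) (hfg : ∀ n, g n = f n) (hab : b = a) : HasSum g b := by
  rw [hab, funext hfg]; exact h

lemma eval_le {f : Circle2Pi → ℂ} (hf : MemFourierAlg f) (x : Circle2Pi) :
    ‖f x‖ ≤ fourierAlgNorm f := by
  rw [mem_series hf x, fourierAlgNorm]
  exact tsum_of_norm_bounded hf.2.hasSum fun n => by simp [ee_norm]

def phi0 : (Circle2Pi → ℂ) →ₗ[ℂ] (Circle2Pi → ℂ) →ₗ[ℂ] ℂ :=
  LinearMap.mk₂ ℂ (fun f g => f 0 * g 0) (by intros; simp [add_mul]) (by intros; simp [mul_assoc])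
    (by intros; simp [mul_add]) (by intros; simp [mul_left_comm])

lemma phi0_apply (f g : Circle2Pi → ℂ) : phi0 f g = f 0 * g 0 := rfl

lemma tents_zero (h₁ h₂ : ℝ) (h10 : 0 ≤ h₁) (h20 : 0 ≤ h₂) (h11 : h₁ ≤ 1) (h21 : h₂ ≤ 1)
    (c : Circle2Pi) (hc : 2 * Real.pi * (h₁ + h₂) < ‖c‖) :
    HasSum (fun n : ℕ => ((tc h₁ n * tc h₂ n : ℝ) : ℂ) * (ee n c + ee (-n) c))
      ((tc h₁ 0 * tc h₂ 0 : ℝ) : ℂ) := by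
  obtain ⟨X, hX, hs⟩ := tents_nat phi0 1 0 le_rfl (fun f g hf hg => by
      rw [phi0_apply, norm_mul, one_mul]
      exact mul_le_mul (eval_le hf 0) (eval_le hg 0) (norm_nonneg _) (norm_nn _))
    (fun f g hf hg h => by
      have : f 0 * g 0 = 0 := by
        by_contra hne
        have : (0 : Circle2Pi) ∈ tsupport f ∩ tsupport g :=
          ⟨subset_tsupport _ (left_ne_zero_of_mul hne), subset_tsupport _ (right_ne_zero_of_mul hne)⟩
        rw [h] at this; exact this
      rw [phi0_apply, this]; simp) h₁ h₂ h10 h20 h11 h21 c hc 0 0 0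
  have hX0 : X = 0 := by simpa using hX
  simpa [phi0_apply, ee_zero', hX0] using hs

lemma beta_pos (h₁ h₂ : ℝ) (n : ℕ) (hn : n ≠ 0) : tc h₁ n * tc h₂ n =
    Real.sin (Real.pi * n * h₁) ^ 2 * Real.sin (Real.pi * n * h₂) ^ 2 /
      (Real.pi ^ 4) * (1 / (n : ℝ) ^ 4) := by
  have : (n : ℤ) ≠ 0 := by exact_mod_cast hn
  rw [tc, tc, if_neg this, if_neg this]
  have := Real.pi_ne_zero
  have : (n : ℝ) ≠ 0 := by exact_mod_cast hn
  push_cast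
  field_simp
  ring

lemma beta_le (h₁ h₂ : ℝ) (n : ℕ) (hn : n ≠ 0) : tc h₁ n * tc h₂ n ≤
    1 / (Real.pi ^ 4) * (1 / (n : ℝ) ^ 4) := by
  rw [beta_pos _ _ _ hn]
  gcongr
  exact mul_le_one₀ (Real.sin_sq_le_one _) (by positivity) (Real.sin_sq_le_one _)

lemma phi_bdd (φ : (Circle2Pi → ℂ) →ₗ[ℂ] (Circle2Pi → ℂ) →ₗ[ℂ] ℂ) (K : ℝ)
    (hK : ∀ f g : Circle2Pi → ℂ, MemFourierAlg f → MemFourierAlg g →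
        ‖φ f g‖ ≤ K * fourierAlgNorm f * fourierAlgNorm g) (m n : ℤ) :
    ‖φ (ee m) (ee n)‖ ≤ |K| := by
  refine (hK _ _ (ee_mem _).1 (ee_mem _).1).trans ?_
  have h3 := (ee_mem m).2
  have h4 := (ee_mem n).2
  have h5 := norm_nn (ee m)
  have h6 := norm_nn (ee n)
  rw [mul_assoc]
  calc K * (fourierAlgNorm (ee m) * fourierAlgNorm (ee n))
      ≤ |K| * (1 * 1) := by gcongr; exact le_abs_self K
    _ = |K| := by ring

lemma norm_center (u : ℝ) (h0 : 0 ≤ u) (h1 : u ≤ 1 / 2) :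
    ‖((2 * Real.pi * u : ℝ) : Circle2Pi)‖ = 2 * Real.pi * u := by
  have hp := Real.pi_pos
  have h : |2 * Real.pi * u| = 2 * Real.pi * u := abs_of_nonneg (by positivity)
  rw [(AddCircle.norm_coe_eq_abs_iff _ (by positivity)).2, h]
  rw [h, abs_of_pos (by positivity)]
  nlinarith

lemma even_bound (φ : (Circle2Pi → ℂ) →ₗ[ℂ] (Circle2Pi → ℂ) →ₗ[ℂ] ℂ) (K α : ℝ) (hα : 0 ≤ α)
    (hK : ∀ f g : Circle2Pi → ℂ, MemFourierAlg f → MemFourierAlg g →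
        ‖φ f g‖ ≤ K * fourierAlgNorm f * fourierAlgNorm g)
    (hd : ∀ f g : Circle2Pi → ℂ, MemFourierAlg f → MemFourierAlg g →
        tsupport f ∩ tsupport g = ∅ →
        ‖φ f g‖ ≤ α * fourierAlgNorm f * fourierAlgNorm g) (j l : ℤ) (k : ℕ) :
    ‖φ (ee (j + k)) (ee (l - k)) + φ (ee (j - k)) (ee (l + k)) - 2 * φ (ee j) (ee l)‖
      ≤ 200 * α := by
  have hp := Real.pi_pos
  set c : Circle2Pi := ((2 * Real.pi * (1 / 2) : ℝ) : Circle2Pi) with hcdef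
  have hc : 2 * Real.pi * (1 / 4 + 1 / 6) < ‖c‖ := by
    rw [hcdef, norm_center _ (by norm_num) (by norm_num)]
    gcongr; norm_num
  have hcc : ∀ n, ee (-n) c = ee n c := by
    intro n
    rw [← ee_neg]
    congr 1
    rw [hcdef, ← AddCircle.coe_neg, ← AddCircle.coe_add_period]; congr 1; ring
  have s1 : Real.sin (Real.pi * (1 : ℕ) * (1 / 4)) ^ 2 = 1 / 2 := by
    rw [show Real.pi * (1 : ℕ) * (1 / 4) = Real.pi / 4 by push_cast; ring, Real.sin_pi_div_four,
      div_pow, Real.sq_sqrt (by norm_num)]; norm_num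
  have s2 : Real.sin (Real.pi * (1 : ℕ) * (1 / 6)) ^ 2 = 1 / 4 := by
    rw [show Real.pi * (1 : ℕ) * (1 / 6) = Real.pi / 6 by push_cast; ring, Real.sin_pi_div_six]
    norm_num
  have nw : ∀ n : ℕ, ‖((tc (1 / 4) n * tc (1 / 6) n : ℝ) : ℂ) * ee n c‖
      = tc (1 / 4) n * tc (1 / 6) n := by
    intro n
    rw [norm_mul, ee_norm, mul_one, Complex.norm_real,
      Real.norm_of_nonneg (mul_nonneg (tc_nonneg _ _) (tc_nonneg _ _))]
  have hw1 : ‖((tc (1 / 4) (1 : ℕ) * tc (1 / 6) (1 : ℕ) : ℝ) : ℂ) * ee (1 : ℕ) c‖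
      = 1 / 8 / Real.pi ^ 4 := by
    rw [nw, beta_pos _ _ _ (by norm_num), s1, s2]; norm_num
  have hnum : 1 / 24 / 200 ≤ 1 / 8 / Real.pi ^ 4 - (1 / Real.pi ^ 4 * (Real.pi ^ 4 / 90)
      - 1 / Real.pi ^ 4 * (1 / ((1 : ℕ) : ℝ) ^ 4)) := by
    have h4 : Real.pi ^ 4 ≤ 3.15 ^ 4 := by
      gcongr; exact Real.pi_lt_d2.le
    have h4' : 0 < Real.pi ^ 4 := by positivity
    have : 1 / 8 / Real.pi ^ 4 - (1 / Real.pi ^ 4 * (Real.pi ^ 4 / 90)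
      - 1 / Real.pi ^ 4 * (1 / ((1 : ℕ) : ℝ) ^ 4)) = (9 / 8) / Real.pi ^ 4 - 1 / 90 := by
      field_simp; push_cast; ring
    rw [this]
    have : (1 / 24 / 200 + 1 / 90 : ℝ) ≤ (9 / 8) / Real.pi ^ 4 := by
      rw [le_div_iff₀ h4']
      norm_num at h4 ⊢
      linarith
    linarith
  have hD := dom (fun k : ℕ => φ (ee (j + k)) (ee (l - k)) + φ (ee (j - k)) (ee (l + k))
      - 2 * φ (ee j) (ee l)) (|K| + |K| + 2 * |K|) (fun n => by
        refine (norm_sub_le _ _).trans (add_le_add ((norm_add_le _ _).trans (add_le_add ?_ ?_)) ?_)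
        · exact phi_bdd φ K hK _ _
        · exact phi_bdd φ K hK _ _
        · rw [norm_mul, Complex.norm_ofNat]
          gcongr; exact phi_bdd φ K hK _ _)
    (by simp; ring) (fun n : ℕ => ((tc (1 / 4) n * tc (1 / 6) n : ℝ) : ℂ) * ee n c)
    (fun n : ℕ => 1 / Real.pi ^ 4 * (1 / (n : ℝ) ^ 4)) (1 / Real.pi ^ 4 * (Real.pi ^ 4 / 90))
    (α * (1 / 4) * (1 / 6)) (by positivity) (hasSum_zeta_four.mul_left _) (by simp)
    (fun n hn => by rw [nw]; exact beta_le _ _ _ (by omega))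
    (by beta_reduce; rw [hw1]; refine lt_of_lt_of_le ?_ hnum; norm_num)
    (fun k _ => by
      obtain ⟨X, hX, hs⟩ := tents_nat φ K α hα hK hd (1 / 4) (1 / 6) (by norm_num) (by norm_num)
        (by norm_num) (by norm_num) c hc j l k
      have hs0 := tents_zero (1 / 4) (1 / 6) (by norm_num) (by norm_num)
        (by norm_num) (by norm_num) c hc
      refine ⟨X, hX, ?_⟩
      refine hs_conv (hs.sub (hs0.mul_right (φ (ee j) (ee l)))) (fun n => ?_) ?_
      · rw [hcc]; push_cast; ring
      · ring) k
  beta_reduce at hD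
  rw [hw1] at hD
  have h5 := (mul_le_mul_of_nonneg_right hnum (norm_nonneg _)).trans hD
  linarith

lemma even_zeta : HasSum (fun n : ℕ => if Even n then 1 / (n : ℝ) ^ 4 else 0)
    (Real.pi ^ 4 / 1440) := by
  have hinj : Function.Injective (fun n : ℕ => 2 * n) := fun a b h => by simpa using h
  rw [← hinj.hasSum_iff]
  · refine hs_conv (hasSum_zeta_four.mul_left (1 / 16)) (fun n => ?_) ?_
    · simp [mul_pow]; ring
    · ring
  · intro n hn
    rw [if_neg]
    rintro ⟨m, rfl⟩
    exact hn ⟨m, by simp only; ring⟩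

lemma odd_bound (φ : (Circle2Pi → ℂ) →ₗ[ℂ] (Circle2Pi → ℂ) →ₗ[ℂ] ℂ) (K α : ℝ) (hα : 0 ≤ α)
    (hK : ∀ f g : Circle2Pi → ℂ, MemFourierAlg f → MemFourierAlg g →
        ‖φ f g‖ ≤ K * fourierAlgNorm f * fourierAlgNorm g)
    (hd : ∀ f g : Circle2Pi → ℂ, MemFourierAlg f → MemFourierAlg g →
        tsupport f ∩ tsupport g = ∅ →
        ‖φ f g‖ ≤ α * fourierAlgNorm f * fourierAlgNorm g) (j l : ℤ) (k : ℕ) :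
    ‖φ (ee (j + k)) (ee (l - k)) - φ (ee (j - k)) (ee (l + k))‖ ≤ 4000 * α := by
  have hp := Real.pi_pos
  set c : Circle2Pi := ((2 * Real.pi * (1 / 4) : ℝ) : Circle2Pi) with hcdef
  have hc : 2 * Real.pi * (1 / 8 + 1 / 9) < ‖c‖ := by
    rw [hcdef, norm_center _ (by norm_num) (by norm_num)]
    gcongr; norm_num
  have hc' : 2 * Real.pi * (1 / 8 + 1 / 9) < ‖-c‖ := by rwa [norm_neg]
  have he1 : ee 1 c = Complex.I := by
    rw [hcdef, ee_coe]
    rw [show (2 * Real.pi * ((1 : ℤ) : ℝ) * (1 / 4)) = Real.pi / 2 by push_cast; ring]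
    push_cast
    exact Complex.exp_pi_div_two_mul_I
  have hem1 : ee (-1) c = -Complex.I := by
    have := ee_add (-1) 1 c
    rw [he1, show (-1 : ℤ) + 1 = 0 by norm_num, ee_zero] at this
    have h2 : ee (-1) c = (ee (-1) c * Complex.I) * (-Complex.I) := by
      rw [mul_assoc]; simp
    rw [h2, ← this, one_mul]
  have hev : ∀ n : ℕ, Even n → ee n c - ee (-n) c = 0 := by
    rintro n ⟨m, rfl⟩
    have h2 : ee 2 c = -1 := by
      rw [show (2 : ℤ) = 1 + 1 by norm_num, ee_add, he1, Complex.I_mul_I]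
    have h2c : (2 : ℤ) • c = -((2 : ℤ) • c) := by
      rw [hcdef, ← AddCircle.coe_zsmul, ← AddCircle.coe_neg, ← AddCircle.coe_add_period _ (-_)]
      congr 1; simp; ring
    have e1 : ((m + m : ℕ) : ℤ) = 2 * (m : ℤ) := by push_cast; ring
    rw [e1, ← mul_neg, ← ee_smul, ← ee_smul, ← ee_neg, ← h2c, sub_self]
  have nb : ∀ n : ℕ, ‖((tc (1 / 8) n * tc (1 / 9) n : ℝ) : ℂ)‖ = tc (1 / 8) n * tc (1 / 9) n := by
    intro n
    rw [Complex.norm_real, Real.norm_of_nonneg (mul_nonneg (tc_nonneg _ _) (tc_nonneg _ _))]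
  set σ := Real.sin (Real.pi * (1 : ℕ) * (1 / 8)) ^ 2 * Real.sin (Real.pi * (1 : ℕ) * (1 / 9)) ^ 2
    with hσ
  have hpi1 := Real.pi_gt_d4
  have hpi2 := Real.pi_lt_d4
  have hσb : 0.016 ≤ σ := by
    have a1 : 0.3773 ≤ Real.sin (Real.pi * (1 : ℕ) * (1 / 8)) := by
      have h1 := Real.sin_gt_sub_cube (x := 0.3926) (by norm_num)
      have h2 : Real.sin 0.3926 ≤ Real.sin (Real.pi * (1 : ℕ) * (1 / 8)) :=
        Real.sin_le_sin_of_le_of_le_pi_div_two (by linarith) (by push_cast; linarith)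
          (by push_cast; linarith)
      norm_num at h1 h2 ⊢; linarith
    have a2 : 0.338 ≤ Real.sin (Real.pi * (1 : ℕ) * (1 / 9)) := by
      have h1 := Real.sin_gt_sub_cube (x := 0.349) (by norm_num)
      have h2 : Real.sin 0.349 ≤ Real.sin (Real.pi * (1 : ℕ) * (1 / 9)) :=
        Real.sin_le_sin_of_le_of_le_pi_div_two (by linarith) (by push_cast; linarith)
          (by push_cast; linarith)
      norm_num at h1 h2 ⊢; linarith
    calc (0.016 : ℝ) ≤ 0.3773 ^ 2 * 0.338 ^ 2 := by norm_num
      _ ≤ σ := by rw [hσ]; gcongr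
  have hw1 : ‖((tc (1 / 8) (1 : ℕ) * tc (1 / 9) (1 : ℕ) : ℝ) : ℂ) *
      (ee (1 : ℕ) c - ee (-(1 : ℕ)) c)‖ = 2 * σ / Real.pi ^ 4 := by
    rw [norm_mul, nb, beta_pos _ _ _ (by norm_num), ← hσ]
    rw [show ((1 : ℕ) : ℤ) = 1 from rfl, he1, hem1, sub_neg_eq_add, ← two_mul, norm_mul]
    simp; ring
  have hnum : 1 / 36 / 4000 ≤ 2 * σ / Real.pi ^ 4 -
      (2 / Real.pi ^ 4 * (Real.pi ^ 4 / 90 - Real.pi ^ 4 / 1440)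
      - 2 / Real.pi ^ 4 * (1 / ((1 : ℕ) : ℝ) ^ 4 -
        if Even (1 : ℕ) then 1 / ((1 : ℕ) : ℝ) ^ 4 else 0)) := by
    have h4 : Real.pi ^ 4 ≤ 3.1416 ^ 4 := by gcongr
    have h4' : 0 < Real.pi ^ 4 := by positivity
    rw [if_neg (by decide)]
    have : 2 * σ / Real.pi ^ 4 - (2 / Real.pi ^ 4 * (Real.pi ^ 4 / 90 - Real.pi ^ 4 / 1440)
      - 2 / Real.pi ^ 4 * (1 / ((1 : ℕ) : ℝ) ^ 4 - 0)) = (2 * σ + 2) / Real.pi ^ 4 - 1 / 48 := by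
      field_simp; push_cast; ring
    rw [this]
    have : (1 / 36 / 4000 + 1 / 48 : ℝ) ≤ (2 * σ + 2) / Real.pi ^ 4 := by
      rw [le_div_iff₀ h4']
      norm_num at h4 hσb ⊢
      linarith
    linarith
  have hD := dom (fun k : ℕ => φ (ee (j + k)) (ee (l - k)) - φ (ee (j - k)) (ee (l + k)))
      (|K| + |K|) (fun n => by
        refine (norm_sub_le _ _).trans (add_le_add ?_ ?_)
        · exact phi_bdd φ K hK _ _
        · exact phi_bdd φ K hK _ _)
    (by simp) (fun n : ℕ => ((tc (1 / 8) n * tc (1 / 9) n : ℝ) : ℂ) * (ee n c - ee (-n) c))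
    (fun n : ℕ => 2 / Real.pi ^ 4 * (1 / (n : ℝ) ^ 4 - if Even n then 1 / (n : ℝ) ^ 4 else 0))
    (2 / Real.pi ^ 4 * (Real.pi ^ 4 / 90 - Real.pi ^ 4 / 1440))
    (α * (1 / 8) * (1 / 9) + α * (1 / 8) * (1 / 9)) (by positivity)
    ((hasSum_zeta_four.sub even_zeta).mul_left _) (by simp)
    (fun n hn => by
      by_cases h : Even n
      · rw [hev n h, if_pos h]; simp
      · rw [if_neg h, norm_mul, nb, sub_zero]
        have h1 : ‖ee n c - ee (-n) c‖ ≤ 2 := by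
          refine (norm_sub_le _ _).trans ?_
          rw [ee_norm, ee_norm]; norm_num
        have h2 := beta_le (1 / 8) (1 / 9) n (by omega)
        calc _ ≤ 1 / (Real.pi ^ 4) * (1 / (n : ℝ) ^ 4) * 2 :=
              mul_le_mul h2 h1 (norm_nonneg _) (by positivity)
          _ = _ := by ring)
    (by beta_reduce; rw [hw1]; refine lt_of_lt_of_le ?_ hnum; norm_num)
    (fun k _ => by
      obtain ⟨X, hX, hs⟩ := tents_nat φ K α hα hK hd (1 / 8) (1 / 9) (by norm_num) (by norm_num)
        (by norm_num) (by norm_num) c hc j l k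
      obtain ⟨Y, hY, hs'⟩ := tents_nat φ K α hα hK hd (1 / 8) (1 / 9) (by norm_num) (by norm_num)
        (by norm_num) (by norm_num) (-c) hc' j l k
      refine ⟨X - Y, (norm_sub_le _ _).trans (add_le_add hX hY), ?_⟩
      refine hs_conv (hs.sub hs') (fun n => ?_) ?_
      · simp only [ee_neg, neg_neg]
        push_cast; ring
      · ring) k
  beta_reduce at hD
  rw [hw1] at hD
  have h5 := (mul_le_mul_of_nonneg_right hnum (norm_nonneg _)).trans hD
  linarith

lemma full_bound (φ : (Circle2Pi → ℂ) →ₗ[ℂ] (Circle2Pi → ℂ) →ₗ[ℂ] ℂ) (K α : ℝ) (hα : 0 ≤ α)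
    (hK : ∀ f g : Circle2Pi → ℂ, MemFourierAlg f → MemFourierAlg g →
        ‖φ f g‖ ≤ K * fourierAlgNorm f * fourierAlgNorm g)
    (hd : ∀ f g : Circle2Pi → ℂ, MemFourierAlg f → MemFourierAlg g →
        tsupport f ∩ tsupport g = ∅ →
        ‖φ f g‖ ≤ α * fourierAlgNorm f * fourierAlgNorm g) (j l k : ℤ) :
    ‖φ (ee (j + k)) (ee (l - k)) - φ (ee j) (ee l)‖ ≤ 2100 * α := by
  have aux : ∀ a b p : ℂ, ‖a + b - 2 * p‖ ≤ 200 * α → ‖a - b‖ ≤ 4000 * α →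
      ‖a - p‖ ≤ 2100 * α ∧ ‖b - p‖ ≤ 2100 * α := by
    intro a b p h1 h2
    constructor
    · have : a - p = (1 / 2 : ℂ) * ((a + b - 2 * p) + (a - b)) := by ring
      rw [this, norm_mul]
      have := norm_add_le (a + b - 2 * p) (a - b)
      norm_num; linarith
    · have : b - p = (1 / 2 : ℂ) * ((a + b - 2 * p) - (a - b)) := by ring
      rw [this, norm_mul]
      have := norm_sub_le (a + b - 2 * p) (a - b)
      norm_num; linarith
  obtain ⟨n, rfl | rfl⟩ := k.eq_nat_or_neg
  · exact (aux _ _ _ (even_bound φ K α hα hK hd j l n) (odd_bound φ K α hα hK hd j l n)).1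
  · have := (aux _ _ _ (even_bound φ K α hα hK hd j l n) (odd_bound φ K α hα hK hd j l n)).2
    simpa [sub_eq_add_neg] using this

def mulL (g : Circle2Pi → ℂ) : (Circle2Pi → ℂ) →ₗ[ℂ] (Circle2Pi → ℂ) := LinearMap.mulLeft ℂ g

lemma mulL_apply (g f : Circle2Pi → ℂ) : mulL g f = fun s => g s * f s := rfl

lemma part1 (φ : (Circle2Pi → ℂ) →ₗ[ℂ] (Circle2Pi → ℂ) →ₗ[ℂ] ℂ) (K α : ℝ) (hα : 0 ≤ α)
    (hK : ∀ f g : Circle2Pi → ℂ, MemFourierAlg f → MemFourierAlg g →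
        ‖φ f g‖ ≤ K * fourierAlgNorm f * fourierAlgNorm g)
    (hd : ∀ f g : Circle2Pi → ℂ, MemFourierAlg f → MemFourierAlg g →
        tsupport f ∩ tsupport g = ∅ →
        ‖φ f g‖ ≤ α * fourierAlgNorm f * fourierAlgNorm g)
    (f g h : Circle2Pi → ℂ) (hf : MemFourierAlg f) (hg : MemFourierAlg g) (hh : MemFourierAlg h) :
    ‖φ (fun s => f s * g s) h - φ f (fun s => g s * h s)‖ ≤
      2100 * α * (fourierAlgNorm f * fourierAlgNorm g * fourierAlgNorm h) := by
  have gb : ∀ f g h : Circle2Pi → ℂ, MemFourierAlg f → MemFourierAlg g → MemFourierAlg h →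
      ‖φ (fun s => f s * g s) h - φ f (fun s => g s * h s)‖ ≤
      2 * |K| * (fourierAlgNorm f * fourierAlgNorm g * fourierAlgNorm h) := by
    intro f g h hf hg hh
    have h1 := hK _ _ (mul_mem hf hg).1 hh
    have h2 := hK _ _ hf (mul_mem hg hh).1
    have n1 := norm_nn f
    have n2 := norm_nn g
    have n3 := norm_nn h
    have n4 := norm_nn (fun s => f s * g s)
    have n5 := norm_nn (fun s => g s * h s)
    have h3 : ‖φ (fun s => f s * g s) h‖ ≤
        |K| * (fourierAlgNorm f * fourierAlgNorm g) * fourierAlgNorm h := by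
      refine h1.trans ?_
      gcongr
      · exact le_abs_self K
      · exact (mul_mem hf hg).2
    have h4 : ‖φ f (fun s => g s * h s)‖ ≤
        |K| * fourierAlgNorm f * (fourierAlgNorm g * fourierAlgNorm h) := by
      refine h2.trans ?_
      gcongr
      · exact le_abs_self K
      · exact (mul_mem hg hh).2
    refine (norm_sub_le _ _).trans ((add_le_add h3 h4).trans (le_of_eq ?_))
    ring
  -- step 0
  have s0 : ∀ a b c, ‖φ (fun s => ee a s * ee b s) (ee c) - φ (ee a) (fun s => ee b s * ee c s)‖
      ≤ 2100 * α := by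
    intro a b c
    have := full_bound φ K α hα hK hd a (b + c) b
    have e1 : (fun s => ee a s * ee b s) = ee (a + b) := by ext s; rw [ee_add]
    have e2 : (fun s => ee b s * ee c s) = ee (b + c) := by ext s; rw [ee_add]
    rw [e1, e2]
    simpa using this
  have s1 : ∀ b c, ‖φ (fun s => f s * ee b s) (ee c) - φ f (fun s => ee b s * ee c s)‖
      ≤ 2100 * α * fourierAlgNorm f := by
    intro b c
    have := L_bound ((φ.flip (ee c)) ∘ₗ (mulL (ee b)) - φ.flip (fun s => ee b s * ee c s))
      (2 * |K| * (fourierAlgNorm (ee b) * fourierAlgNorm (ee c))) (fun f hf => by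
        have := gb f (ee b) (ee c) hf (ee_mem b).1 (ee_mem c).1
        simp only [LinearMap.sub_apply, LinearMap.comp_apply, LinearMap.flip_apply, mulL_apply,
          mul_comm (ee b _) (f _)]
        refine this.trans (le_of_eq (by ring))) (2100 * α) (fun n => by
        have := s0 n b c
        simpa only [LinearMap.sub_apply, LinearMap.comp_apply, LinearMap.flip_apply, mulL_apply,
          mul_comm (ee b _) (ee n _)] using this) f hf
    simpa only [LinearMap.sub_apply, LinearMap.comp_apply, LinearMap.flip_apply, mulL_apply,
          mul_comm (ee b _) (f _)] using this
  have s2 : ∀ b, ‖φ (fun s => f s * ee b s) h - φ f (fun s => ee b s * h s)‖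
      ≤ 2100 * α * fourierAlgNorm f * fourierAlgNorm h := by
    intro b
    have := L_bound (φ (fun s => f s * ee b s) - (φ f) ∘ₗ (mulL (ee b)))
      (2 * |K| * (fourierAlgNorm f * fourierAlgNorm (ee b))) (fun h hh => by
        have := gb f (ee b) h hf (ee_mem b).1 hh
        simp only [LinearMap.sub_apply, LinearMap.comp_apply, mulL_apply]
        refine this.trans (le_of_eq (by ring))) (2100 * α * fourierAlgNorm f) (fun n => by
        have := s1 b n
        simpa only [LinearMap.sub_apply, LinearMap.comp_apply, mulL_apply] using this) h hh
    simpa only [LinearMap.sub_apply, LinearMap.comp_apply, mulL_apply] using this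
  have := L_bound ((φ.flip h) ∘ₗ (mulL f) - (φ f) ∘ₗ (mulL h))
      (2 * |K| * (fourierAlgNorm f * fourierAlgNorm h)) (fun g hg => by
        have := gb f g h hf hg hh
        simp only [LinearMap.sub_apply, LinearMap.comp_apply, LinearMap.flip_apply, mulL_apply,
          mul_comm (h _) (g _)]
        refine this.trans (le_of_eq (by ring))) (2100 * α * fourierAlgNorm f * fourierAlgNorm h)
      (fun n => by
        have := s2 n
        simpa only [LinearMap.sub_apply, LinearMap.comp_apply, LinearMap.flip_apply, mulL_apply,
          mul_comm (h _) (ee n _)] using this) g hg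
  simp only [LinearMap.sub_apply, LinearMap.comp_apply, LinearMap.flip_apply, mulL_apply,
          mul_comm (h _) (g _)] at this
  refine this.trans (le_of_eq (by ring))

lemma const_le : (2100 : ℝ) ≤ 288 * Real.pi * (1 + Real.sqrt 2) := by
  have h1 := Real.pi_gt_d2
  have h2 : (1.41 : ℝ) ≤ Real.sqrt 2 := Real.le_sqrt_of_sq_le (by norm_num)
  calc (2100 : ℝ) ≤ 288 * 3.14 * (1 + 1.41) := by norm_num
    _ ≤ _ := by gcongr

lemma part1' (φ : (Circle2Pi → ℂ) →ₗ[ℂ] (Circle2Pi → ℂ) →ₗ[ℂ] ℂ) (K α : ℝ) (hα : 0 ≤ α)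
    (hK : ∀ f g : Circle2Pi → ℂ, MemFourierAlg f → MemFourierAlg g →
        ‖φ f g‖ ≤ K * fourierAlgNorm f * fourierAlgNorm g)
    (hd : ∀ f g : Circle2Pi → ℂ, MemFourierAlg f → MemFourierAlg g →
        tsupport f ∩ tsupport g = ∅ →
        ‖φ f g‖ ≤ α * fourierAlgNorm f * fourierAlgNorm g)
    (f g h : Circle2Pi → ℂ) (hf : MemFourierAlg f) (hg : MemFourierAlg g) (hh : MemFourierAlg h) :
    ‖φ (fun s => f s * g s) h - φ f (fun s => g s * h s)‖ ≤
      288 * Real.pi * (1 + Real.sqrt 2) * α *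
        (fourierAlgNorm f * fourierAlgNorm g * fourierAlgNorm h) := by
  refine (part1 φ K α hα hK hd f g h hf hg hh).trans ?_
  have n1 := norm_nn f
  have n2 := norm_nn g
  have n3 := norm_nn h
  gcongr
  exact const_le

theorem stmt_3 :
    (∀ (φ : (Circle2Pi → ℂ) →ₗ[ℂ] (Circle2Pi → ℂ) →ₗ[ℂ] ℂ),
      (∃ K : ℝ, ∀ f g : Circle2Pi → ℂ, MemFourierAlg f → MemFourierAlg g →
        ‖φ f g‖ ≤ K * fourierAlgNorm f * fourierAlgNorm g) →
      ∀ α : ℝ, 0 ≤ α →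
      (∀ f g : Circle2Pi → ℂ, MemFourierAlg f → MemFourierAlg g →
        tsupport f ∩ tsupport g = ∅ →
        ‖φ f g‖ ≤ α * fourierAlgNorm f * fourierAlgNorm g) →
      ∀ f g h : Circle2Pi → ℂ, MemFourierAlg f → MemFourierAlg g → MemFourierAlg h →
        ‖φ (fun s => f s * g s) h - φ f (fun s => g s * h s)‖ ≤
          288 * Real.pi * (1 + Real.sqrt 2) * α *
            (fourierAlgNorm f * fourierAlgNorm g * fourierAlgNorm h))
    ∧
    -- In particular, `A(𝕋)` has the strong property (B) with constant `288π(1+√2)`.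
    (∀ (X : Type) [NormedAddCommGroup X] [NormedSpace ℂ X] [CompleteSpace X]
      (φ : (Circle2Pi → ℂ) →ₗ[ℂ] (Circle2Pi → ℂ) →ₗ[ℂ] X),
      (∃ K : ℝ, ∀ f g : Circle2Pi → ℂ, MemFourierAlg f → MemFourierAlg g →
        ‖φ f g‖ ≤ K * fourierAlgNorm f * fourierAlgNorm g) →
      ∀ α : ℝ, 0 ≤ α →
      (∀ f g : Circle2Pi → ℂ, MemFourierAlg f → MemFourierAlg g →
        (∀ x, f x * g x = 0) →
        ‖φ f g‖ ≤ α * fourierAlgNorm f * fourierAlgNorm g) →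
      ∀ f g h : Circle2Pi → ℂ, MemFourierAlg f → MemFourierAlg g → MemFourierAlg h →
        ‖φ (fun s => f s * g s) h - φ f (fun s => g s * h s)‖ ≤
          288 * Real.pi * (1 + Real.sqrt 2) * α *
            (fourierAlgNorm f * fourierAlgNorm g * fourierAlgNorm h)) := by

  constructor
  · rintro φ ⟨K, hK⟩ α hα hd f g h hf hg hh
    exact part1' φ K α hα hK hd f g h hf hg hh
  · rintro X _ _ _ φ ⟨K, hK⟩ α hα hd f g h hf hg hh
    obtain ⟨ℓ, hℓ, hx⟩ := exists_dual_vector'' ℂ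
      (φ (fun s => f s * g s) h - φ f (fun s => g s * h s))
    have hle : ∀ x, ‖ℓ x‖ ≤ ‖x‖ := fun x =>
      (ℓ.le_of_opNorm_le hℓ x).trans (le_of_eq (one_mul _))
    have := part1' (φ.compr₂ (ℓ : X →ₗ[ℂ] ℂ)) K α hα
      (fun f g hf hg => (hle _).trans (hK f g hf hg))
      (fun f g hf hg hfg => (hle _).trans (hd f g hf hg (fun x => by
        by_contra hne
        have : x ∈ tsupport f ∩ tsupport g :=
          ⟨subset_tsupport _ (left_ne_zero_of_mul hne), subset_tsupport _ (right_ne_zero_of_mul hne)⟩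
        rw [hfg] at this; exact this))) f g h hf hg hh
    refine le_trans (le_of_eq ?_) this
    have e : (φ.compr₂ (ℓ : X →ₗ[ℂ] ℂ)) (fun s => f s * g s) h
        - (φ.compr₂ (ℓ : X →ₗ[ℂ] ℂ)) f (fun s => g s * h s)
        = ℓ (φ (fun s => f s * g s) h - φ f (fun s => g s * h s)) := by
      rw [map_sub]; rfl
    rw [e, hx]
    simp
end
end

section
/- Every C*-algebra A has the strong property (B) with constant 288π(1+√2): for every Banach space X, every bounded bilinear map φ : A × A → X, and every α ≥ 0 such that ‖φ(a,b)‖ ≤ α‖a‖‖b‖ whenever a, b ∈ A satisfy ab = 0, one has ‖φ(ab,c) − φ(a,bc)‖ ≤ 288π(1+√2)·α·‖a‖‖b‖‖c‖ for all a, b, c ∈ A. -/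
namespace StrongB

/-- If all signed sums are bounded by `M`, so is the diagonal sum. -/
lemma sign_avg {A X : Type*} [NonUnitalNormedRing A] [NormedSpace ℂ A]
    [NormedAddCommGroup X] [NormedSpace ℂ X]
    (φ : A →L[ℂ] A →L[ℂ] X) (u v : ℕ → A) (M : ℝ) (m : ℕ) :
    ∀ U V : A, (∀ ε : ℕ → ℝ, (∀ k, |ε k| ≤ 1) →
      ‖φ (U + ∑ k ∈ Finset.range m, ε k • u k) (V + ∑ k ∈ Finset.range m, ε k • v k)‖ ≤ M) →
    ‖φ U V + ∑ k ∈ Finset.range m, φ (u k) (v k)‖ ≤ M := by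
  induction m with
  | zero =>
    intro U V h
    simpa using h (fun _ => 0) (by simp)
  | succ m ih =>
    intro U V h
    have key : ∀ s : ℝ, |s| ≤ 1 → ‖φ (U + s • u m) (V + s • v m) +
        ∑ k ∈ Finset.range m, φ (u k) (v k)‖ ≤ M := by
      intro s hs
      apply ih
      intro ε hε
      have h1 := h (fun k => if k = m then s else ε k) (by
        intro k; split_ifs
        · exact hs
        · exact hε k)
      have e : ∀ w : ℕ → A, ∑ k ∈ Finset.range (m+1), (if k = m then s else ε k) • w k
          = s • w m + ∑ k ∈ Finset.range m, ε k • w k := by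
        intro w
        rw [Finset.sum_range_succ, add_comm]
        congr 1
        · simp
        · refine Finset.sum_congr rfl fun k hk => ?_
          rw [if_neg (Finset.mem_range.1 hk).ne]
      rw [e, e] at h1
      simpa only [add_assoc] using h1
    have h1 := key 1 (by simp)
    have h2 := key (-1) (by simp)
    simp only [one_smul, neg_smul] at h1 h2
    rw [Finset.sum_range_succ]
    set S := ∑ k ∈ Finset.range m, φ (u k) (v k)
    have e : φ U V + (S + φ (u m) (v m)) = (2⁻¹ : ℝ) • ((φ (U + u m) (V + v m) + S) +
        (φ (U + -u m) (V + -v m) + S)) := by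
      simp only [map_add, map_neg, add_apply, neg_apply]
      module
    rw [e, norm_smul]
    have := norm_add_le (φ (U + u m) (V + v m) + S) (φ (U + -u m) (V + -v m) + S)
    rw [Real.norm_of_nonneg (by norm_num)]
    linarith

/-- The clamp functions. -/
noncomputable def f (N : ℝ) (k : ℕ) (x : ℝ) : ℝ := max 0 (min 1 (N * x - k))

lemma f_cont (N : ℝ) (k : ℕ) : Continuous (f N k) := by unfold f; fun_prop

lemma f_zero (N : ℝ) (k : ℕ) : f N k 0 = 0 := by
  have : (0:ℝ) ≤ k := k.cast_nonneg
  unfold f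
  rw [max_eq_left]
  exact (min_le_right _ _).trans (by simp)

lemma f_nonneg (N : ℝ) (k : ℕ) (x : ℝ) : 0 ≤ f N k x := le_max_left _ _

lemma f_le_one (N : ℝ) (k : ℕ) (x : ℝ) : f N k x ≤ 1 :=
  max_le zero_le_one (min_le_left _ _)

lemma f_anti (N : ℝ) (k : ℕ) (x : ℝ) : f N (k+1) x ≤ f N k x := by
  unfold f
  push_cast
  gcongr
  linarith

lemma f_mul (N : ℝ) (k : ℕ) (x : ℝ) : f N (k+1) x * f N k x = f N (k+1) x := by
  unfold f
  push_cast
  rcases le_total (N * x - k) 1 with h | h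
  · have : max 0 (min 1 (N * x - (k+1))) = 0 := by
      rw [max_eq_left]
      exact (min_le_right _ _).trans (by linarith)
    rw [this]; simp
  · rw [min_eq_left h]; simp

lemma f_sum (N : ℝ) (m : ℕ) (x : ℝ) :
    ∑ k ∈ Finset.range m, f N k x = max 0 (min (m : ℝ) (N * x)) := by
  induction m with
  | zero => simp
  | succ m ih =>
    rw [Finset.sum_range_succ, ih]
    unfold f
    push_cast
    have : (0:ℝ) ≤ m := m.cast_nonneg
    simp only [max_def, min_def]
    split_ifs <;> linarith

lemma f_signed (N : ℝ) (ε : ℕ → ℝ) (hε : ∀ k, |ε k| ≤ 1) (m i : ℕ) (x : ℝ) :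
    |∑ k ∈ Finset.range m, ε k * (f N (k+i) x - f N (k+i+1) x)| ≤ 1 := by
  calc _ ≤ ∑ k ∈ Finset.range m, |ε k * (f N (k+i) x - f N (k+i+1) x)| :=
        Finset.abs_sum_le_sum_abs _ _
    _ ≤ ∑ k ∈ Finset.range m, (f N (k+i) x - f N (k+1+i) x) := by
        refine Finset.sum_le_sum fun k _ => ?_
        have h := sub_nonneg.2 (f_anti N (k+i) x)
        rw [abs_mul, abs_of_nonneg h, add_right_comm k 1 i]
        exact mul_le_of_le_one_left h (hε k)
    _ = f N (0+i) x - f N (m+i) x := Finset.sum_range_sub' (fun k => f N (k+i) x) m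
    _ ≤ 1 := by linarith [f_nonneg N (m+i) x, f_le_one N (0+i) x]

section
variable {A : Type*} [NonUnitalCStarAlgebra A]

/-- The elements `f N k (b)`. -/
noncomputable def F (b : A) (N : ℝ) (k : ℕ) : A := cfcₙ (f N k) b

lemma F_norm (b : A) (N : ℝ) (k : ℕ) : ‖F b N k‖ ≤ 1 := by
  refine norm_cfcₙ_le fun x _ => ?_
  rw [Real.norm_of_nonneg (f_nonneg N k x)]
  exact f_le_one N k x

lemma F_mul (b : A) (N : ℝ) (k : ℕ) : F b N (k+1) * F b N k = F b N (k+1) := by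
  unfold F
  rw [← cfcₙ_mul (f N (k+1)) (f N k) b (f_cont _ _).continuousOn (f_zero _ _)
    (f_cont _ _).continuousOn (f_zero _ _)]
  exact cfcₙ_congr fun x _ => f_mul N k x

lemma F_mul' (b : A) (N : ℝ) (k : ℕ) : F b N k * F b N (k+1) = F b N (k+1) := by
  unfold F
  rw [← cfcₙ_mul (f N k) (f N (k+1)) b (f_cont _ _).continuousOn (f_zero _ _)
    (f_cont _ _).continuousOn (f_zero _ _)]
  exact cfcₙ_congr fun x _ => (mul_comm _ _).trans (f_mul N k x)

lemma F_sum (b : A) (hb : IsSelfAdjoint b) (hb1 : ‖b‖ ≤ 1) (n : ℕ) :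
    ∑ k ∈ Finset.range n, F b n k = (n : ℝ) • b⁺ := by
  unfold F
  rw [← cfcₙ_sum (fun k => f n k) b _ (fun k _ => (f_cont _ _).continuousOn)
    (fun k _ => f_zero _ _), CFC.posPart_def, ← cfcₙ_smul (n : ℝ) (fun x : ℝ => x⁺) b]
  refine cfcₙ_congr fun x hx => ?_
  have hx1 := NonUnitalIsometricContinuousFunctionalCalculus.norm_quasispectrum_le b hx hb
  have hx2 : x ≤ 1 := (Real.le_norm_self x).trans (hx1.trans hb1)
  have hn : (0:ℝ) ≤ n := n.cast_nonneg
  simp only [Finset.sum_apply, f_sum, smul_eq_mul, posPart_def]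
  rw [min_eq_right (mul_le_of_le_one_right hn hx2), max_comm]
  change _ = (n:ℝ) * max x 0
  rw [mul_max_of_nonneg _ _ hn, mul_zero]

lemma F_signed (b : A) (N : ℝ) (ε : ℕ → ℝ) (hε : ∀ k, |ε k| ≤ 1) (m i : ℕ) :
    ‖∑ k ∈ Finset.range m, ε k • (F b N (k+i) - F b N (k+i+1))‖ ≤ 1 := by
  have hc : ∀ k, Continuous (fun x => f N (k+i) x - f N (k+i+1) x) :=
    fun k => (f_cont _ _).sub (f_cont _ _)
  have h0 : ∀ k, f N (k+i) 0 - f N (k+i+1) 0 = 0 := fun k => by simp [f_zero]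
  have e : ∑ k ∈ Finset.range m, ε k • (F b N (k+i) - F b N (k+i+1)) =
      cfcₙ (∑ k ∈ Finset.range m, fun x => ε k • (f N (k+i) x - f N (k+i+1) x)) b := by
    rw [cfcₙ_sum (fun k x => ε k • (f N (k+i) x - f N (k+i+1) x)) b _
      (fun k _ => ((hc k).const_smul (ε k)).continuousOn)
      (fun k _ => by rw [h0, smul_zero])]
    refine Finset.sum_congr rfl fun k _ => ?_
    rw [cfcₙ_smul (ε k) _ b (hc k).continuousOn (h0 k),
      cfcₙ_sub _ _ b (f_cont _ _).continuousOn (f_zero _ _)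
        (f_cont _ _).continuousOn (f_zero _ _)]
    rfl
  rw [e]
  refine norm_cfcₙ_le fun x _ => ?_
  simpa [Real.norm_eq_abs] using f_signed N ε hε m i x

variable {X : Type*} [NormedAddCommGroup X] [NormedSpace ℂ X]

lemma bd (φ : A →L[ℂ] A →L[ℂ] X) {x y : A} {p q : ℝ} (hx : ‖x‖ ≤ p) (hy : ‖y‖ ≤ q) :
    ‖φ x y‖ ≤ ‖φ‖ * p * q := by
  refine (φ.le_opNorm₂ x y).trans ?_
  have := norm_nonneg φ
  have := (norm_nonneg x).trans hx
  gcongr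

lemma mul_bd {x y : A} {p q : ℝ} (hx : ‖x‖ ≤ p) (hy : ‖y‖ ≤ q) : ‖x * y‖ ≤ p * q := by
  refine (norm_mul_le x y).trans ?_
  have := (norm_nonneg x).trans hx
  gcongr

lemma zbd (φ : A →L[ℂ] A →L[ℂ] X) (α : ℝ) (hα : 0 ≤ α)
    (hzero : ∀ a b : A, a * b = 0 → ‖φ a b‖ ≤ α * ‖a‖ * ‖b‖)
    {x y : A} (h : x * y = 0) {p q : ℝ} (hx : ‖x‖ ≤ p) (hy : ‖y‖ ≤ q) :
    ‖φ x y‖ ≤ α * p * q := by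
  refine (hzero x y h).trans ?_
  have := (norm_nonneg x).trans hx
  gcongr

lemma offdiag (φ : A →L[ℂ] A →L[ℂ] X) (a c b : A) (N : ℝ) (n i j : ℕ) :
    ‖∑ k ∈ Finset.range n, φ (a * (F b N (k+i) - F b N (k+i+1)))
      ((F b N (k+j) - F b N (k+j+1)) * c)‖ ≤ ‖φ‖ * ‖a‖ * ‖c‖ := by
  have := sign_avg φ (fun k => a * (F b N (k+i) - F b N (k+i+1)))
    (fun k => (F b N (k+j) - F b N (k+j+1)) * c) (‖φ‖ * ‖a‖ * ‖c‖) n 0 0 ?_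
  · simpa using this
  · intro ε hε
    simp only [zero_add, ← mul_smul_comm, ← Finset.mul_sum]
    simp only [mul_smul_comm, ← smul_mul_assoc, ← Finset.sum_mul]
    refine bd φ ?_ ?_
    · simpa using mul_bd (le_refl ‖a‖) (F_signed b N ε hε n i)
    · simpa using mul_bd (F_signed b N ε hε n j) (le_refl ‖c‖)

lemma single (φ : A →L[ℂ] A →L[ℂ] X) (α : ℝ) (hα : 0 ≤ α)
    (hzero : ∀ a b : A, a * b = 0 → ‖φ a b‖ ≤ α * ‖a‖ * ‖b‖) (a c b : A) (N : ℝ) (k : ℕ) :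
    ‖φ (a * F b N (k+1)) c - φ a (F b N (k+1) * c)
      - φ (a * (F b N (k+1) - F b N (k+1+1))) ((F b N (k+0) - F b N (k+0+1)) * c)
      + φ (a * (F b N (k+0) - F b N (k+0+1))) ((F b N (k+1) - F b N (k+1+1)) * c)‖
      ≤ 8 * α * ‖a‖ * ‖c‖ := by
  have nH := F_norm b N k
  have nF := F_norm b N (k+1)
  have nG := F_norm b N (k+2)
  have FH := F_mul b N k
  have HF := F_mul' b N k
  have GF := F_mul b N (k+1)
  have FG := F_mul' b N (k+1)
  simp only [add_zero]
  have t : k + 1 + 1 = k + 2 := rfl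
  rw [t] at *
  generalize F b N k = H at *
  generalize F b N (k+2) = G at *
  generalize F b N (k+1) = F at *
  have GH : G * H = G := by rw [← GF, mul_assoc, FH]
  have HG : H * G = G := by rw [← FG, ← mul_assoc, HF]
  have nHF : ‖H - F‖ ≤ 2 := (norm_sub_le _ _).trans (by linarith)
  have ncH : ‖c - H * c‖ ≤ 2 * ‖c‖ :=
    (norm_sub_le _ _).trans (by linarith [mul_bd nH (le_refl ‖c‖)])
  have naH : ‖a - a * H‖ ≤ 2 * ‖a‖ :=
    (norm_sub_le _ _).trans (by linarith [mul_bd (le_refl ‖a‖) nH])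
  have h1 := zbd φ α hα hzero (x := a * F) (y := c - H * c) (by
    rw [mul_sub, ← mul_assoc, mul_assoc a F H, FH, sub_self]) (mul_bd (le_refl ‖a‖) nF) ncH
  have h2 := zbd φ α hα hzero (x := a * G) (y := (H - F) * c) (by
    rw [← mul_assoc, mul_assoc a G, mul_sub, GH, GF, sub_self, mul_zero, zero_mul])
    (mul_bd (le_refl ‖a‖) nG) (mul_bd nHF (le_refl ‖c‖))
  have h3 := zbd φ α hα hzero (x := a - a * H) (y := F * c) (by
    rw [sub_mul, ← mul_assoc, ← mul_assoc, mul_assoc a H F, HF, sub_self]) naH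
    (mul_bd nF (le_refl ‖c‖))
  have h4 := zbd φ α hα hzero (x := a * (H - F)) (y := G * c) (by
    rw [← mul_assoc, mul_assoc a _ G, sub_mul, HG, FG, sub_self, mul_zero, zero_mul])
    (mul_bd (le_refl ‖a‖) nHF) (mul_bd nG (le_refl ‖c‖))
  have e : φ (a * F) c - φ a (F * c) - φ (a * (F - G)) ((H - F) * c)
      + φ (a * (H - F)) ((F - G) * c) =
      φ (a * F) (c - H * c) + φ (a * G) ((H - F) * c)
      - φ (a - a * H) (F * c) - φ (a * (H - F)) (G * c) := by
    simp only [mul_sub, sub_mul, map_sub, sub_apply]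
    abel
  rw [e]
  have := norm_sub_le (φ (a * F) (c - H * c) + φ (a * G) ((H - F) * c)
      - φ (a - a * H) (F * c)) (φ (a * (H - F)) (G * c))
  have := norm_sub_le (φ (a * F) (c - H * c) + φ (a * G) ((H - F) * c)) (φ (a - a * H) (F * c))
  have := norm_add_le (φ (a * F) (c - H * c)) (φ (a * G) ((H - F) * c))
  nlinarith

lemma pos_n (φ : A →L[ℂ] A →L[ℂ] X) (α : ℝ) (hα : 0 ≤ α)
    (hzero : ∀ a b : A, a * b = 0 → ‖φ a b‖ ≤ α * ‖a‖ * ‖b‖) (a c b : A)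
    (hb : IsSelfAdjoint b) (hb1 : ‖b‖ ≤ 1) (n : ℕ) :
    (n + 1) * ‖φ (a * b⁺) c - φ a (b⁺ * c)‖ ≤
      n * (8 * α * ‖a‖ * ‖c‖) + 4 * (‖φ‖ * ‖a‖ * ‖c‖) := by
  have hs := F_sum b hb hb1 (n+1)
  set N : ℝ := ((n+1 : ℕ) : ℝ) with hN
  have hN0 : 0 ≤ N := Nat.cast_nonneg _
  have e1 : N • (φ (a * b⁺) c - φ a (b⁺ * c)) =
      ∑ k ∈ Finset.range (n+1), (φ (a * F b N k) c - φ a (F b N k * c)) := by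
    rw [Finset.sum_sub_distrib, ← map_sum, ← Finset.sum_mul, hs]
    have : ∑ k ∈ Finset.range (n+1), φ (a * F b N k) c = φ (a * (N • b⁺)) c := by
      rw [← hs, Finset.mul_sum, map_sum, sum_apply]
    rw [this, mul_smul_comm, smul_mul_assoc, smul_sub, ContinuousLinearMap.map_smul_of_tower,
      ContinuousLinearMap.map_smul_of_tower]
    rfl
  have h := norm_sum_le_of_le (Finset.range n)
    (fun k _ => single φ α hα hzero a c b N k)
  rw [Finset.sum_const, Finset.card_range, nsmul_eq_mul, Finset.sum_add_distrib,
    Finset.sum_sub_distrib] at h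
  have o1 := offdiag φ a c b N n 1 0
  have o2 := offdiag φ a c b N n 0 1
  set R := ∑ k ∈ Finset.range n, φ (a * (F b N (k+1) - F b N (k+1+1)))
      ((F b N (k+0) - F b N (k+0+1)) * c)
  set R' := ∑ k ∈ Finset.range n, φ (a * (F b N (k+0) - F b N (k+0+1)))
      ((F b N (k+1) - F b N (k+1+1)) * c)
  rw [Finset.sum_range_succ'] at e1
  set S := ∑ k ∈ Finset.range n, (φ (a * F b N (k+1)) c - φ a (F b N (k+1) * c))
  have z1 := bd φ (mul_bd (le_refl ‖a‖) (F_norm b N 0)) (le_refl ‖c‖)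
  have z2 := bd φ (le_refl ‖a‖) (mul_bd (F_norm b N 0) (le_refl ‖c‖))
  have e2 : N • (φ (a * b⁺) c - φ a (b⁺ * c)) = (S - R + R') + R - R' +
      (φ (a * F b N 0) c - φ a (F b N 0 * c)) := by rw [e1]; abel
  have e3 : (n + 1) * ‖φ (a * b⁺) c - φ a (b⁺ * c)‖ = ‖N • (φ (a * b⁺) c - φ a (b⁺ * c))‖ := by
    rw [norm_smul, Real.norm_of_nonneg hN0, hN]; push_cast; rfl
  rw [e3, e2]
  have := norm_add_le ((S - R + R') + R - R') (φ (a * F b N 0) c - φ a (F b N 0 * c))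
  have := norm_sub_le ((S - R + R') + R) R'
  have := norm_add_le (S - R + R') R
  have := norm_sub_le (φ (a * F b N 0) c) (φ a (F b N 0 * c))
  linarith

lemma pos (φ : A →L[ℂ] A →L[ℂ] X) (α : ℝ) (hα : 0 ≤ α)
    (hzero : ∀ a b : A, a * b = 0 → ‖φ a b‖ ≤ α * ‖a‖ * ‖b‖) (a c b : A)
    (hb : IsSelfAdjoint b) (hb1 : ‖b‖ ≤ 1) :
    ‖φ (a * b⁺) c - φ a (b⁺ * c)‖ ≤ 8 * α * ‖a‖ * ‖c‖ := by
  by_contra! hlt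
  have h := pos_n φ α hα hzero a c b hb hb1
  set D := ‖φ (a * b⁺) c - φ a (b⁺ * c)‖
  have hD : 0 ≤ D := norm_nonneg _
  set K := 8 * α * ‖a‖ * ‖c‖
  obtain ⟨n, hn⟩ := exists_nat_gt ((4 * (‖φ‖ * ‖a‖ * ‖c‖)) / (D - K))
  rw [div_lt_iff₀ (sub_pos.2 hlt)] at hn
  have := h n
  nlinarith

lemma sa (φ : A →L[ℂ] A →L[ℂ] X) (α : ℝ) (hα : 0 ≤ α)
    (hzero : ∀ a b : A, a * b = 0 → ‖φ a b‖ ≤ α * ‖a‖ * ‖b‖) (a c b : A)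
    (hb : IsSelfAdjoint b) (hb1 : ‖b‖ ≤ 1) :
    ‖φ (a * b) c - φ a (b * c)‖ ≤ 16 * α * ‖a‖ * ‖c‖ := by
  have h1 := pos φ α hα hzero a c b hb hb1
  have h2 := pos φ α hα hzero a c (-b) hb.neg (by simpa using hb1)
  rw [CFC.posPart_neg] at h2
  have e : φ (a * b) c - φ a (b * c) = (φ (a * b⁺) c - φ a (b⁺ * c)) -
      (φ (a * b⁻) c - φ a (b⁻ * c)) := by
    conv_lhs => rw [← CFC.posPart_sub_negPart b hb]
    simp only [mul_sub, sub_mul, map_sub, sub_apply]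
    abel
  rw [e]
  have := norm_sub_le (φ (a * b⁺) c - φ a (b⁺ * c)) (φ (a * b⁻) c - φ a (b⁻ * c))
  linarith

lemma unit_ball (φ : A →L[ℂ] A →L[ℂ] X) (α : ℝ) (hα : 0 ≤ α)
    (hzero : ∀ a b : A, a * b = 0 → ‖φ a b‖ ≤ α * ‖a‖ * ‖b‖) (a c b : A) (hb1 : ‖b‖ ≤ 1) :
    ‖φ (a * b) c - φ a (b * c)‖ ≤ 32 * α * ‖a‖ * ‖c‖ := by
  have h1 := sa φ α hα hzero a c _ (realPart b).2 ((realPart.norm_le b).trans hb1)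
  have h2 := sa φ α hα hzero a c _ (imaginaryPart b).2 ((imaginaryPart.norm_le b).trans hb1)
  have e0 := realPart_add_I_smul_imaginaryPart b
  generalize (realPart b : A) = r at *
  generalize (imaginaryPart b : A) = s at *
  have e : φ (a * b) c - φ a (b * c) = (φ (a * r) c - φ a (r * c)) +
      Complex.I • (φ (a * s) c - φ a (s * c)) := by
    rw [← e0]
    simp only [mul_add, add_mul, map_add, add_apply, mul_smul_comm, smul_mul_assoc,
      map_smul, smul_apply, smul_sub]
    abel
  rw [e]
  have := norm_add_le (φ (a * r) c - φ a (r * c)) (Complex.I • (φ (a * s) c - φ a (s * c)))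
  rw [norm_smul, Complex.norm_I, one_mul] at this
  linarith

lemma general (φ : A →L[ℂ] A →L[ℂ] X) (α : ℝ) (hα : 0 ≤ α)
    (hzero : ∀ a b : A, a * b = 0 → ‖φ a b‖ ≤ α * ‖a‖ * ‖b‖) (a b c : A) :
    ‖φ (a * b) c - φ a (b * c)‖ ≤ 32 * α * ‖a‖ * ‖b‖ * ‖c‖ := by
  rcases eq_or_ne b 0 with rfl | hb
  · simp
  have hb' : 0 < ‖b‖ := norm_pos_iff.2 hb
  have h := unit_ball φ α hα hzero a c (((‖b‖⁻¹ : ℝ) : ℂ) • b) (by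
    rw [norm_smul, Complex.norm_real, norm_inv, norm_norm, inv_mul_cancel₀ hb'.ne'])
  simp only [mul_smul_comm, smul_mul_assoc, map_smul, smul_apply, ← smul_sub] at h
  rw [norm_smul, Complex.norm_real, norm_inv, norm_norm, inv_mul_le_iff₀ hb'] at h
  linarith

end

end StrongB

/-- Every C*-algebra has the strong property (B) with constant `288π(1+√2)`. -/
theorem stmt_4 (A : Type*) [NonUnitalNormedRing A] [StarRing A] [CStarRing A]
    [NormedSpace ℂ A] [IsScalarTower ℂ A A] [SMulCommClass ℂ A A] [StarModule ℂ A]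
    [CompleteSpace A]
    (X : Type*) [NormedAddCommGroup X] [NormedSpace ℂ X] [CompleteSpace X]
    (φ : A →L[ℂ] A →L[ℂ] X) (α : ℝ) (hα : 0 ≤ α)
    (hzero : ∀ a b : A, a * b = 0 → ‖φ a b‖ ≤ α * ‖a‖ * ‖b‖) :
    ∀ a b c : A, ‖φ (a * b) c - φ a (b * c)‖ ≤
      288 * Real.pi * (1 + Real.sqrt 2) * α * ‖a‖ * ‖b‖ * ‖c‖ := by
  intro a b c
  letI : NonUnitalCStarAlgebra A := {}
  refine (StrongB.general φ α hα hzero a b c).trans ?_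
  have h1 : (32:ℝ) ≤ 288 * Real.pi * (1 + Real.sqrt 2) := by
    nlinarith [Real.pi_gt_three, Real.sqrt_nonneg 2]
  gcongr
end
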